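/- arXiv:2402.10467 — 2 statements merged into one kernel-verified Lean document; each statement's English description precedes it below -/
import Mathlib

section
/- Let q ≥ 9 be a prime power with q ≡ 1 (mod 4), and let G = PSL₂(q). Then for every irreducible complex character χ of G whose degree lies in {q − 1, q, q + 1} and every irreducible complex character ψ of G, the inner product ⟨χ², ψ⟩ is nonzero; that is, c(χ²) = Irr(G). -/
open scoped BigOperators

/-- The standard inner product of complex-valued class functions on a finite group:
`⟨α, β⟩ = |G|⁻¹ ∑ g, α g * conj (β g)`. -/
noncomputable def charInner {G : Type} [Group G] [Finite G] (α β : G → ℂ) : ℂ :=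
  letI : Fintype G := Fintype.ofFinite G
  (Fintype.card G : ℂ)⁻¹ * ∑ g : G, α g * (starRingEnd ℂ) (β g)

/-- `χ : G → ℂ` is an irreducible character if it is the character of some
irreducible (simple) finite-dimensional complex representation of `G`. -/
def IsIrreducibleCharacter (G : Type) [Group G] (χ : G → ℂ) : Prop :=
  ∃ V : FDRep ℂ G, CategoryTheory.Simple V ∧ χ = V.character

section AbelianGroup

variable {A : Type} [AddCommGroup A] [Fintype A]

/-- The multiplicities of the linear characters in a representation of a finite abelian group. -/
lemma exists_multiplicities {V : Type} [AddCommGroup V] [Module ℂ V] [FiniteDimensional ℂ V]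
    (ρ : Representation ℂ (Multiplicative A) V) :
    ∃ m : AddChar A ℂ → ℕ,
      (∀ β, (Fintype.card A : ℂ) * m β
        = ∑ a, β (-a) * ρ.character (Multiplicative.ofAdd a)) ∧
      ∀ a, ρ.character (Multiplicative.ofAdd a) = ∑ β, (m β : ℂ) * β a := by
  classical
  have hA : (Fintype.card A : ℂ) ≠ 0 := Nat.cast_ne_zero.2 Fintype.card_ne_zero
  have key (β : AddChar A ℂ) : ∃ n : ℕ, (Fintype.card A : ℂ) * n
      = ∑ a, β (-a) * ρ.character (Multiplicative.ofAdd a) := by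
    let σ : Representation ℂ (Multiplicative A) V :=
      { toFun := fun a => β (-a.toAdd) • ρ a
        map_one' := by simp
        map_mul' := fun a b => by
          simp [AddChar.map_add_eq_mul, neg_add_rev, smul_smul, mul_comm] }
    have : Invertible (Nat.card (Multiplicative A) : ℂ) :=
      invertibleOfNonzero (by simp)
    have h := σ.card_inv_mul_sum_char_eq_finrank
    refine ⟨_, (congrArg ((Fintype.card A : ℂ) * ·) h).symm.trans ?_⟩
    have hc : Nat.card (Multiplicative A) = Fintype.card A := by simp
    simp only [hc]
    rw [← mul_assoc, mul_inv_cancel₀ hA, one_mul, ← Multiplicative.ofAdd.sum_comp]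
    exact Finset.sum_congr rfl fun a _ => by simp [σ, Representation.character]
  choose m hm using key
  refine ⟨m, hm, fun a => mul_left_cancel₀ hA ?_⟩
  simp_rw [Finset.mul_sum, ← mul_assoc, hm, Finset.sum_mul]
  rw [Finset.sum_comm, Finset.sum_eq_single a]
  · simp [mul_right_comm, ← AddChar.map_add_eq_mul]
  · intro b _ hb
    have : ∑ β : AddChar A ℂ, β (-b + a) = 0 :=
      AddChar.sum_apply_eq_zero_iff_ne_zero.2 fun h => hb (neg_add_eq_zero.1 h)
    rw [← zero_mul (ρ.character (Multiplicative.ofAdd b)), ← this, Finset.sum_mul]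
    exact Finset.sum_congr rfl fun β _ => by rw [AddChar.map_add_eq_mul]; ring
  · simp

/-- Integral combinations of characters of a finite abelian group. -/
def IsVirtualCharacter (φ : A → ℂ) (u k : ℤ) : Prop :=
  ∃ n : AddChar A ℂ → ℤ, (∀ a, φ a = ∑ β, (n β : ℂ) * β a) ∧ ∑ β, n β = u ∧ ∑ β, n β ^ 2 = k

lemma sum_norm_sq_of_combination (n : AddChar A ℂ → ℂ) (φ : A → ℂ)
    (h : ∀ a, φ a = ∑ β, n β * β a) :
    ∑ a, φ a * (starRingEnd ℂ) (φ a) =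
      Fintype.card A * ∑ β, n β * (starRingEnd ℂ) (n β) := by
  classical
  simp_rw [h, map_sum, map_mul, ← AddChar.map_neg_eq_conj, Finset.sum_mul_sum]
  rw [Finset.sum_comm, Finset.mul_sum]
  refine Finset.sum_congr rfl fun β _ => ?_
  rw [Finset.sum_comm, Finset.sum_eq_single β]
  · have (a : A) : n β * β a * ((starRingEnd ℂ) (n β) * β (-a)) = n β * (starRingEnd ℂ) (n β) := by
      rw [mul_mul_mul_comm, ← AddChar.map_add_eq_mul]
      simp
    simp [this]
  · intro γ _ hγ
    have : ∑ a, (β - γ) a = 0 := AddChar.sum_eq_zero_iff_ne_zero.2 (sub_ne_zero.2 hγ.symm)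
    rw [← mul_zero (n β * (starRingEnd ℂ) (n γ)), ← this, Finset.mul_sum]
    exact Finset.sum_congr rfl fun a _ => by rw [AddChar.sub_apply, mul_mul_mul_comm]
  · simp

namespace IsVirtualCharacter

variable {φ : A → ℂ} {u k : ℤ}

lemma nonneg (h : IsVirtualCharacter φ u k) : 0 ≤ k := by
  obtain ⟨n, -, -, rfl⟩ := h
  positivity

lemma apply_zero (h : IsVirtualCharacter φ u k) : φ 0 = u := by
  obtain ⟨n, h1, rfl, -⟩ := h
  simp [h1]

lemma sum_norm_sq (h : IsVirtualCharacter φ u k) :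
    ∑ a, φ a * (starRingEnd ℂ) (φ a) = Fintype.card A * k := by
  obtain ⟨n, h1, -, rfl⟩ := h
  rw [sum_norm_sq_of_combination _ _ h1]
  simp [sq]

lemma norm_le (h : IsVirtualCharacter φ u k) (a : A) : ‖φ a‖ ≤ k := by
  obtain ⟨n, h1, -, rfl⟩ := h
  rw [h1]
  push_cast
  refine (norm_sum_le _ _).trans (Finset.sum_le_sum fun β _ => ?_)
  rw [norm_mul, AddChar.norm_apply, mul_one, ← sq_abs (n β : ℝ)]
  simp only [Complex.norm_intCast]
  have : |n β| ≤ |n β| ^ 2 := Int.le_self_sq _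
  exact_mod_cast this

lemma abs_le (h : IsVirtualCharacter φ u k) : |u| ≤ k := by
  have := h.norm_le 0
  rw [h.apply_zero, Complex.norm_intCast] at this
  exact_mod_cast this

lemma sum_normSq (h : IsVirtualCharacter φ u k) : ∑ a, ‖φ a‖ ^ 2 = Fintype.card A * k := by
  have := h.sum_norm_sq
  simp only [Complex.mul_conj, Complex.normSq_eq_norm_sq] at this
  exact_mod_cast this

variable {ψ : A → ℂ} {v l : ℤ}

lemma abs_re_sq_mul_conj_le (hψ : IsVirtualCharacter ψ v l) (φ : A → ℂ) (a : A) :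
    |(φ a ^ 2 * (starRingEnd ℂ) (ψ a)).re| ≤ l * ‖φ a‖ ^ 2 := by
  refine (Complex.abs_re_le_norm _).trans ?_
  rw [norm_mul, norm_pow, RCLike.norm_conj, mul_comm]
  exact mul_le_mul_of_nonneg_right (hψ.norm_le a) (by positivity)

lemma re_sum_sq_mul_conj_le (h : IsVirtualCharacter φ u k) (hψ : IsVirtualCharacter ψ v l) :
    (∑ a, φ a ^ 2 * (starRingEnd ℂ) (ψ a)).re ≤ l * (Fintype.card A * k) := by
  rw [Complex.re_sum, ← h.sum_normSq, Finset.mul_sum]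
  exact Finset.sum_le_sum fun a _ => (abs_le'.1 (hψ.abs_re_sq_mul_conj_le φ a)).1

lemma re_sq_mul_conj_eq (h : IsVirtualCharacter φ u k) (hψ : IsVirtualCharacter ψ v l)
    (heq : l * (Fintype.card A * k) ≤ (∑ a, φ a ^ 2 * (starRingEnd ℂ) (ψ a)).re) (a : A) :
    (φ a ^ 2 * (starRingEnd ℂ) (ψ a)).re = l * ‖φ a‖ ^ 2 := by
  have heq := le_antisymm (h.re_sum_sq_mul_conj_le hψ) heq
  rw [Complex.re_sum, ← h.sum_normSq, Finset.mul_sum] at heq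
  exact (Finset.sum_eq_sum_iff_of_le
    fun a _ => (abs_le'.1 (hψ.abs_re_sq_mul_conj_le φ a)).1).1 heq a (Finset.mem_univ a)

lemma sq_mul_add_le (h : IsVirtualCharacter φ u k) (hψ : IsVirtualCharacter ψ v l) :
    (u ^ 2 * (l + v) : ℝ) ≤
      l * (Fintype.card A * k) + (∑ a, φ a ^ 2 * (starRingEnd ℂ) (ψ a)).re := by
  rw [Complex.re_sum, ← h.sum_normSq, Finset.mul_sum, ← Finset.sum_add_distrib]
  refine le_trans (le_of_eq ?_) (Finset.single_le_sum (fun a _ => ?_) (Finset.mem_univ 0))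
  · rw [h.apply_zero, hψ.apply_zero, map_intCast, Complex.norm_intCast, sq_abs]
    norm_cast
    ring
  · have := (abs_le'.1 (hψ.abs_re_sq_mul_conj_le φ a)).2
    linarith

lemma conj_apply (h : IsVirtualCharacter φ u k) (a : A) :
    (starRingEnd ℂ) (φ a) = φ (-a) := by
  obtain ⟨n, h1, -, -⟩ := h
  simp [h1, AddChar.map_neg_eq_conj]

lemma eq_zero (h : IsVirtualCharacter φ u 0) (a : A) : φ a = 0 := by
  simpa using h.norm_le a

/-- A sum of two distinct characters trivial on `z` has no zero at an element having an
odd multiple in `{0, z}`. -/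
lemma ne_zero_of_odd (h : IsVirtualCharacter φ 2 2) {z a : A} (hz : z + z = 0) (hφz : φ z = 2)
    {N : ℕ} (hN : Odd N) (ha : N • a = 0 ∨ N • a = z) : φ a ≠ 0 := by
  classical
  obtain ⟨n, h1, h2, h3⟩ := h
  have h4 : ∀ β, n β = 0 ∨ n β = 1 := by
    have h5 : ∑ β, (n β ^ 2 - n β) = 0 := by rw [Finset.sum_sub_distrib, h2, h3]; norm_num
    rw [Finset.sum_eq_zero_iff_of_nonneg fun β _ => sub_nonneg.2 (Int.le_self_sq _)] at h5
    intro β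
    have := h5 β (Finset.mem_univ _)
    rcases mul_eq_zero.1 (show n β * (n β - 1) = 0 by linarith) with h | h
    · exact Or.inl h
    · exact Or.inr (by omega)
  have h5 : (Finset.univ.filter fun β => n β = 1).card = 2 := by
    have : ∑ β, n β = ∑ β, if n β = 1 then 1 else 0 :=
      Finset.sum_congr rfl fun β _ => by rcases h4 β with h | h <;> simp [h]
    rw [h2, Finset.sum_boole] at this
    exact_mod_cast this.symm
  obtain ⟨β, γ, hne, hS⟩ := Finset.card_eq_two.1 h5
  have h6 (x : A) : φ x = β x + γ x := by
    rw [h1, ← Finset.sum_pair (f := fun δ : AddChar A ℂ => δ x) hne, ← hS, Finset.sum_filter]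
    exact Finset.sum_congr rfl fun δ _ => by rcases h4 δ with h | h <;> simp [h]
  have sq1 (δ : AddChar A ℂ) : δ z = 1 ∨ δ z = -1 := by
    rw [← sq_eq_one_iff, sq, ← AddChar.map_add_eq_mul, hz, AddChar.map_zero_eq_one]
  have hβγ : β z = 1 ∧ γ z = 1 := by
    rw [h6] at hφz
    rcases sq1 β with h | h <;> rcases sq1 γ with h' | h' <;> rw [h, h'] at hφz <;>
      norm_num at hφz
    exact ⟨h, h'⟩
  have h7 (δ : AddChar A ℂ) (hδ : δ z = 1) : δ a ^ N = 1 := by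
    rw [← AddChar.map_nsmul_eq_pow]
    rcases ha with h | h <;> simp [h, hδ]
  intro h8
  rw [h6, add_eq_zero_iff_eq_neg] at h8
  have h9 := h7 β hβγ.1
  rw [h8, hN.neg_pow, h7 γ hβγ.2] at h9
  norm_num at h9

lemma neg (h : IsVirtualCharacter φ u k) : IsVirtualCharacter (fun a => -φ a) (-u) k := by
  obtain ⟨n, h1, rfl, rfl⟩ := h
  exact ⟨fun β => -n β, by simp [h1], by simp, by simp⟩

end IsVirtualCharacter

/-- Subtracting copies of the regular representation of the quotient of `A` by an involution. -/
lemma exists_isVirtualCharacter_sub_regular {ψ : A → ℂ} (m : AddChar A ℂ → ℕ)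
    (h : ∀ a, ψ a = ∑ β, (m β : ℂ) * β a) {z : A} (hz : z + z = 0) (hz0 : z ≠ 0) (s : ℕ)
    [DecidablePred fun a => a = 0 ∨ a = z] :
    ∃ u k, IsVirtualCharacter
      (fun a => ψ a - if a = 0 ∨ a = z then (s : ℂ) * (Fintype.card A / 2) else 0) u k := by
  classical
  refine ⟨_, _, fun β => (m β : ℤ) - s * if β z = 1 then 1 else 0, fun a => ?_, rfl, rfl⟩
  have hβ (β : AddChar A ℂ) : ((if β z = 1 then 1 else 0 : ℤ) : ℂ) = (1 + β z) / 2 := by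
    have : β z = 1 ∨ β z = -1 := by
      rw [← sq_eq_one_iff, sq, ← AddChar.map_add_eq_mul, hz, AddChar.map_zero_eq_one]
    rcases this with h | h <;> rw [h] <;> norm_num
  have hsum : ∑ β : AddChar A ℂ, (1 + β z) / 2 * β a
      = (if a = 0 ∨ a = z then (Fintype.card A : ℂ) / 2 else 0) := by
    have : ∑ β : AddChar A ℂ, (1 + β z) / 2 * β a
        = (∑ β : AddChar A ℂ, β a + ∑ β : AddChar A ℂ, β (a + z)) / 2 := by
      rw [← Finset.sum_add_distrib, Finset.sum_div]
      exact Finset.sum_congr rfl fun β _ => by rw [AddChar.map_add_eq_mul]; ring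
    have haz : a + z = 0 ↔ a = z := by
      rw [add_eq_zero_iff_eq_neg, ← add_eq_zero_iff_eq_neg.1 hz]
    rw [this, AddChar.sum_apply_eq_ite, AddChar.sum_apply_eq_ite]
    by_cases h0 : a = 0
    · subst h0
      simp [hz0]
    · by_cases h1 : a = z <;> simp [h0, h1, haz, hz0, hz]
  push_cast at hβ ⊢
  simp_rw [hβ, sub_mul, Finset.sum_sub_distrib, h, mul_assoc, ← Finset.mul_sum, hsum]
  simp

end AbelianGroup

section SpecialLinear

open Matrix

variable {F : Type} [Field F]

namespace SL2

/-- The matrix entries of an element of `SL₂`. -/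
def entry (g : SpecialLinearGroup (Fin 2) F) (i j : Fin 2) : F := g.1 i j

/-- The element of `SL₂` with given entries. -/
def ofEntries (a b c d : F) (h : a * d - b * c = 1) : SpecialLinearGroup (Fin 2) F :=
  ⟨!![a, b; c, d], by rw [det_fin_two_of, h]⟩

section entries

variable {a b c d : F} (h : a * d - b * c = 1)

@[simp] lemma entry_ofEntries_zero_zero : entry (ofEntries a b c d h) 0 0 = a := rfl
@[simp] lemma entry_ofEntries_zero_one : entry (ofEntries a b c d h) 0 1 = b := rfl
@[simp] lemma entry_ofEntries_one_zero : entry (ofEntries a b c d h) 1 0 = c := rfl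
@[simp] lemma entry_ofEntries_one_one : entry (ofEntries a b c d h) 1 1 = d := rfl

lemma ext_entries {g h : SpecialLinearGroup (Fin 2) F} (h00 : entry g 0 0 = entry h 0 0)
    (h01 : entry g 0 1 = entry h 0 1) (h10 : entry g 1 0 = entry h 1 0)
    (h11 : entry g 1 1 = entry h 1 1) : g = h := by
  refine Subtype.ext (Matrix.ext fun i j => ?_)
  fin_cases i <;> fin_cases j <;> assumption

@[simp] lemma entry_mul (g h : SpecialLinearGroup (Fin 2) F) (i j : Fin 2) :
    entry (g * h) i j = entry g i 0 * entry h 0 j + entry g i 1 * entry h 1 j := by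
  change (g.1 * h.1) i j = _
  rw [mul_apply, Fin.sum_univ_two]
  rfl

@[simp] lemma entry_neg (g : SpecialLinearGroup (Fin 2) F) (i j : Fin 2) :
    entry (-g) i j = -entry g i j := rfl

@[simp] lemma entry_one_zero_zero : entry (1 : SpecialLinearGroup (Fin 2) F) 0 0 = 1 := rfl
@[simp] lemma entry_one_zero_one : entry (1 : SpecialLinearGroup (Fin 2) F) 0 1 = 0 := rfl
@[simp] lemma entry_one_one_zero : entry (1 : SpecialLinearGroup (Fin 2) F) 1 0 = 0 := rfl
@[simp] lemma entry_one_one_one : entry (1 : SpecialLinearGroup (Fin 2) F) 1 1 = 1 := rfl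

lemma entry_det (g : SpecialLinearGroup (Fin 2) F) :
    entry g 0 0 * entry g 1 1 - entry g 0 1 * entry g 1 0 = 1 := by
  have := g.2
  rwa [det_fin_two] at this

lemma inv_eq_ofEntries (g : SpecialLinearGroup (Fin 2) F) :
    g⁻¹ = ofEntries (entry g 1 1) (-entry g 0 1) (-entry g 1 0) (entry g 0 0)
      (by linear_combination entry_det g) := by
  rw [inv_eq_iff_mul_eq_one]
  have := entry_det g
  apply ext_entries <;> simp
  · linear_combination this
  · ring
  · ring
  · linear_combination this

end entries

/-- Upper unitriangular matrices. -/
def upper (x : F) : SpecialLinearGroup (Fin 2) F := ofEntries 1 x 0 1 (by simp)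

/-- Upper triangular matrices. -/
def borel (a : Fˣ) (b : F) : SpecialLinearGroup (Fin 2) F :=
  ofEntries (a : F) b 0 (a : F)⁻¹ (by simp)

/-- The matrix with lower row `c, d` and upper left entry `a`, for `c` invertible. -/
def bigCell (c : Fˣ) (a d : F) : SpecialLinearGroup (Fin 2) F :=
  ofEntries a ((a * d - 1) * (c : F)⁻¹) c d (by simp)

/-- The diagonal torus. -/
def diag : Fˣ →* SpecialLinearGroup (Fin 2) F where
  toFun a := borel a 0
  map_one' := by apply ext_entries <;> simp [borel]
  map_mul' a b := by apply ext_entries <;> simp [borel, mul_comm]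

lemma diag_apply (a : Fˣ) : diag a = borel a 0 := rfl

/-- The torus of matrices commuting with `!![0, δ; 1, 0]`. -/
def torus (δ : F) : Subgroup (SpecialLinearGroup (Fin 2) F) where
  carrier := {g | entry g 0 0 = entry g 1 1 ∧ entry g 0 1 = δ * entry g 1 0}
  mul_mem' := by
    rintro a b ⟨h1, h2⟩ ⟨h3, h4⟩
    simp only [Set.mem_ofPred_eq, entry_mul, h1, h2, h3, h4]
    constructor <;> ring
  one_mem' := by simp
  inv_mem' := by
    rintro a ⟨h1, h2⟩
    simp [inv_eq_ofEntries, h1, h2]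

lemma mem_torus {δ : F} {g : SpecialLinearGroup (Fin 2) F} :
    g ∈ torus δ ↔ entry g 0 0 = entry g 1 1 ∧ entry g 0 1 = δ * entry g 1 0 := Iff.rfl

instance (δ : F) : CommGroup (torus δ) :=
  { (torus δ).toGroup with
    mul_comm := by
      rintro ⟨a, h1, h2⟩ ⟨b, h3, h4⟩
      refine Subtype.ext ?_
      change a * b = b * a
      apply ext_entries <;> simp [h1, h2, h3, h4] <;> ring }

lemma borel_neg_one (b : F) : borel (-1) b = -upper (-b) := by
  apply ext_entries <;> simp [borel, upper]

lemma borel_one (b : F) : borel 1 b = upper b := by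
  apply ext_entries <;> simp [borel, upper]

lemma upper_zero : upper (0 : F) = 1 := by
  apply ext_entries <;> simp [upper]

lemma upper_add (x y : F) : upper (x + y) = upper x * upper y := by
  apply ext_entries <;> simp [upper, add_comm]

lemma diag_neg_one : diag (-1 : Fˣ) = -1 := by
  simp [diag_apply, borel_neg_one, upper_zero]

lemma diag_conj_upper (a : Fˣ) (x : F) :
    diag a * upper x * (diag a)⁻¹ = upper ((a : F) ^ 2 * x) := by
  rw [mul_inv_eq_iff_eq_mul]
  apply ext_entries <;> simp [diag_apply, borel, upper]
  field_simp

lemma bigCell_neg_two (c : Fˣ) : bigCell c 0 (-2) = -bigCell (-c) 0 2 := by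
  apply ext_entries <;> simp [bigCell]

/-- The coordinates on the two Bruhat cells. -/
def ofCells : (Fˣ × F) ⊕ (Fˣ × F × F) → SpecialLinearGroup (Fin 2) F
  | .inl p => borel p.1 p.2
  | .inr p => bigCell p.1 p.2.1 p.2.2

lemma ofCells_bijective : Function.Bijective (ofCells (F := F)) := by
  constructor
  · rintro (⟨a, b⟩ | ⟨c, a, d⟩) (⟨a', b'⟩ | ⟨c', a', d'⟩) h <;>
    have h00 := congrArg (fun g => entry g 0 0) h <;>
    have h01 := congrArg (fun g => entry g 0 1) h <;>
    have h10 := congrArg (fun g => entry g 1 0) h <;>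
    have h11 := congrArg (fun g => entry g 1 1) h <;>
    simp only [ofCells, borel, bigCell, entry_ofEntries_zero_zero, entry_ofEntries_zero_one,
      entry_ofEntries_one_zero, entry_ofEntries_one_one, Sum.inl.injEq, Sum.inr.injEq,
      Prod.mk.injEq, reduceCtorEq] at h00 h01 h10 h11 ⊢
    · exact ⟨Units.ext h00, h01⟩
    · exact (Units.ne_zero _ h10.symm).elim
    · exact (Units.ne_zero _ h10).elim
    · exact ⟨Units.ext h10, h00, h11⟩
  · intro g
    have hd := entry_det g
    by_cases hc : entry g 1 0 = 0
    · rw [hc, mul_zero, sub_zero] at hd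
      refine ⟨Sum.inl (Units.mkOfMulEqOne _ _ hd, entry g 0 1), ?_⟩
      apply ext_entries <;> simp [ofCells, borel, hc]
      exact (eq_inv_of_mul_eq_one_right hd).symm
    · refine ⟨Sum.inr (Units.mk0 _ hc, entry g 0 0, entry g 1 1), ?_⟩
      apply ext_entries <;> simp [ofCells, bigCell]
      field_simp
      linear_combination hd

variable {f : SpecialLinearGroup (Fin 2) F → ℂ}

lemma apply_eq_of_mul_eq (hf : ∀ g h, f (h * g * h⁻¹) = f g)
    {g g' h : SpecialLinearGroup (Fin 2) F} (e : h * g = g' * h) : f g = f g' := by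
  rw [← hf g h, e, mul_inv_cancel_right]

/-- An element of `SL₂` is conjugate to a companion matrix
if `v, g v` is a basis of determinant one for some vector `v = (x, y)`. -/
lemma apply_eq_companion_of_vector (hf : ∀ g h, f (h * g * h⁻¹) = f g)
    (g : SpecialLinearGroup (Fin 2) F) (x y : F)
    (hxy : x * (entry g 1 0 * x + entry g 1 1 * y) - y * (entry g 0 0 * x + entry g 0 1 * y) = 1) :
    f g = f (bigCell 1 0 (entry g 0 0 + entry g 1 1)) := by
  have hd := entry_det g
  refine (apply_eq_of_mul_eq hf (h := ofEntries x (entry g 0 0 * x + entry g 0 1 * y) y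
    (entry g 1 0 * x + entry g 1 1 * y) (by linear_combination hxy)) ?_).symm
  apply ext_entries <;> simp [bigCell]
  · linear_combination x * hd
  · linear_combination y * hd

lemma apply_bigCell (hf : ∀ g h, f (h * g * h⁻¹) = f g) (c : Fˣ) (a d : F) :
    f (bigCell c a d) = f (bigCell c 0 (a + d)) := by
  refine (apply_eq_of_mul_eq hf (h := upper (a * (c : F)⁻¹)) ?_).symm
  apply ext_entries <;> simp [bigCell, upper] <;> field_simp
  ring

lemma apply_borel (hf : ∀ g h, f (h * g * h⁻¹) = f g) {a : Fˣ} (h1 : a ≠ 1) (h2 : a ≠ -1)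
    (b : F) : f (borel a b) = f (diag a) := by
  have h3 : (a : F) - (a : F)⁻¹ ≠ 0 := by
    intro h
    have : (a : F) ^ 2 = 1 := by
      have ha := a.mul_inv
      rw [Units.val_inv_eq_inv_val] at ha
      linear_combination a * h + ha
    rcases sq_eq_one_iff.1 this with h | h
    · exact h1 (Units.ext h)
    · exact h2 (Units.ext h)
  refine (apply_eq_of_mul_eq hf (h := upper (-b / ((a : F) - (a : F)⁻¹))) ?_).symm
  apply ext_entries <;> simp [diag_apply, borel, upper]
  linear_combination (norm := ring_nf) b * inv_mul_cancel₀ h3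

lemma apply_companion_two (hf : ∀ g h, f (h * g * h⁻¹) = f g) (c : Fˣ) :
    f (bigCell c 0 2) = f (upper (-c)) := by
  refine (apply_eq_of_mul_eq hf (h := ofEntries (-(c : F)⁻¹) (-1) 1 0 (by simp)) ?_).symm
  apply ext_entries <;> simp [bigCell, upper]
  ring

variable [Fintype F]

lemma apply_eq_companion (h2F : (2 : F) ≠ 0) (hf : ∀ g h, f (h * g * h⁻¹) = f g)
    (g : SpecialLinearGroup (Fin 2) F) (hc : entry g 1 0 ≠ 0)
    (ht : (entry g 0 0 + entry g 1 1) ^ 2 ≠ 4) :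
    f g = f (bigCell 1 0 (entry g 0 0 + entry g 1 1)) := by
  have hd := entry_det g
  set t := entry g 0 0 + entry g 1 1 with ht'
  obtain ⟨X, y, hXy⟩ : ∃ X y : F, X ^ 2 - (t ^ 2 - 4) * y ^ 2 = 4 * entry g 1 0 := by
    classical
    open Polynomial in
    obtain ⟨X₀, y, h⟩ := FiniteField.exists_root_sum_quadratic
      (f := (X ^ 2 - C (4 * entry g 1 0) : F[X])) (g := C (4 - t ^ 2) * X ^ 2 + C 0 * X + C 0)
      (degree_X_pow_sub_C (by norm_num) _)
      (degree_quadratic (sub_ne_zero.2 ht.symm))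
      (FiniteField.odd_card_of_char_ne_two fun h => h2F (by
        have := CharP.cast_eq_zero F (ringChar F)
        rwa [h] at this))
    simp at h
    exact ⟨X₀, y, by linear_combination h⟩
  refine apply_eq_companion_of_vector hf g
    ((X - (entry g 1 1 - entry g 0 0) * y) / (2 * entry g 1 0)) y ?_
  have h4 : (4 : F) ≠ 0 := by
    have : (4 : F) = 2 * 2 := by norm_num
    rw [this]; exact mul_ne_zero h2F h2F
  refine mul_left_cancel₀ (mul_ne_zero h4 hc) ?_
  field_simp
  rw [ht'] at hXy
  linear_combination hXy + 4 * y ^ 2 * hd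

end SL2
end SpecialLinear

section Summation

open Matrix

variable {F : Type} [Field F]

namespace SL2

lemma sum_eq_zero_add_sum_units [Fintype F] [DecidableEq F] {M : Type*} [AddCommMonoid M]
    (f : F → M) : ∑ x, f x = f 0 + ∑ x : Fˣ, f x := by
  rw [Fintype.sum_eq_add_sum_subtype_ne f 0, ← unitsEquivNeZero.sum_comp]
  rfl

variable {f : SpecialLinearGroup (Fin 2) F → ℂ}

lemma neg_one_mem_torus (δ : F) : -1 ∈ torus δ := by simp [mem_torus]

lemma entry_one_zero_ne_zero {δ : F}
    {s : SpecialLinearGroup (Fin 2) F} (hs : s ∈ torus δ) (h1 : s ≠ 1) (h2 : s ≠ -1) :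
    entry s 1 0 ≠ 0 := by
  intro h
  obtain ⟨h3, h4⟩ := hs
  have hd := entry_det s
  rw [h, mul_zero] at h4
  rw [h, h3, mul_zero, sub_zero, ← sq] at hd
  rcases sq_eq_one_iff.1 hd with h5 | h5
  · exact h1 (ext_entries (by simp [h3, h5]) (by simp [h4]) (by simp [h]) (by simp [h5]))
  · exact h2 (ext_entries (by simp [h3, h5]) (by simp [h4]) (by simp [h]) (by simp [h5]))

lemma trace_sq_ne_four (h2F : (2 : F) ≠ 0) {δ : F} (hδ : δ ≠ 0)
    {s : SpecialLinearGroup (Fin 2) F} (hs : s ∈ torus δ) (h1 : s ≠ 1) (h2 : s ≠ -1) :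
    (entry s 0 0 + entry s 1 1) ^ 2 ≠ 4 := by
  intro h
  have hc := entry_one_zero_ne_zero hs h1 h2
  obtain ⟨h3, h4⟩ := hs
  have hd := entry_det s
  rw [h3, h4] at hd
  rw [h3] at h
  have : (2 : F) * 2 * δ * (entry s 1 0) ^ 2 = 0 := by linear_combination h - 4 * hd
  simp_all

lemma eq_one_or_neg_one_of_sq_eq_one (h2F : (2 : F) ≠ 0) {δ : F}
    {x : SpecialLinearGroup (Fin 2) F} (hx : x ∈ torus δ) (h : x * x = 1) : x = 1 ∨ x = -1 := by
  by_contra! hne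
  have hc := entry_one_zero_ne_zero hx hne.1 hne.2
  obtain ⟨h1, h2⟩ := hx
  have h3 := entry_det x
  have h4 := congrArg (fun y => entry y 1 0) h
  have h5 := congrArg (fun y => entry y 0 0) h
  simp only [entry_mul, entry_one_one_zero, entry_one_zero_zero] at h4 h5
  rw [h1] at h3 h4 h5
  rw [h2] at h3 h5
  have h6 : entry x 1 1 = 0 := by
    have : 2 * entry x 1 0 * entry x 1 1 = 0 := by linear_combination h4
    simpa [h2F, hc] using this
  rw [h6] at h3 h5
  exact h2F (by linear_combination -h3 - h5)

lemma sq_eq_four_iff {t : F} : t ^ 2 = 4 ↔ t = 2 ∨ t = -2 := by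
  rw [← sq_eq_sq_iff_eq_or_eq_neg]
  norm_num

lemma add_inv_sq_ne_four {a : Fˣ} (h1 : a ≠ 1) (h2 : a ≠ -1) :
    ((a : F) + (a : F)⁻¹) ^ 2 ≠ 4 := by
  intro h
  have ha : (a : F) * (a : F)⁻¹ = 1 := by simp
  have : ((a : F) - (a : F)⁻¹) ^ 2 = 0 := by linear_combination h - 4 * ha
  have h3 : (a : F) ^ 2 = 1 := by
    rw [pow_eq_zero_iff two_ne_zero] at this
    linear_combination a * this + ha
  rcases sq_eq_one_iff.1 h3 with h | h
  · exact h1 (Units.ext h)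
  · exact h2 (Units.ext h)

lemma apply_diag (hf : ∀ g h, f (h * g * h⁻¹) = f g) {a : Fˣ} (h1 : a ≠ 1) (h2 : a ≠ -1) :
    f (diag a) = f (bigCell 1 0 ((a : F) + (a : F)⁻¹)) := by
  have h3 : (a : F)⁻¹ - (a : F) ≠ 0 := by
    intro h
    apply add_inv_sq_ne_four h1 h2
    have ha : (a : F) * (a : F)⁻¹ = 1 := by simp
    linear_combination ((a : F)⁻¹ - a) * h + 4 * ha
  have := apply_eq_companion_of_vector hf (diag a) 1 ((a : F)⁻¹ - (a : F))⁻¹ (by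
    simp only [diag_apply, borel, entry_ofEntries_zero_zero, entry_ofEntries_zero_one,
      entry_ofEntries_one_zero, entry_ofEntries_one_one]
    linear_combination inv_mul_cancel₀ h3)
  simpa [diag_apply, borel] using this

lemma ringChar_ne_two (h2F : (2 : F) ≠ 0) : ringChar F ≠ 2 := fun h => h2F (by
  have := CharP.cast_eq_zero F (ringChar F)
  rwa [h] at this)

variable [Fintype F] [DecidableEq F]

lemma natCast_card_units : (Fintype.card Fˣ : ℂ) = Fintype.card F - 1 := by
  rw [Fintype.card_units, Nat.cast_sub Fintype.card_pos, Nat.cast_one]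

noncomputable instance (δ : F) : Fintype (torus δ) := Fintype.ofFinite _

lemma card_add_inv_eq (h2F : (2 : F) ≠ 0) (t : F) :
    ((Finset.univ.filter fun a : Fˣ => (a : F) + (a : F)⁻¹ = t).card : ℤ)
      = quadraticChar F (t ^ 2 - 4) + 1 := by
  rw [← quadraticChar_card_sqrts (ringChar_ne_two h2F)]
  have hx (x : F) (hx : x ^ 2 = t ^ 2 - 4) : (t + x) * 2⁻¹ ≠ 0 := by
    intro h
    have h4 : (t + x) = 0 := by simpa [h2F] using h
    have : (2 : F) * 2 = 0 := by linear_combination (t - x) * h4 + hx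
    simp_all
  congr 1
  refine Finset.card_bij (fun a _ => 2 * (a : F) - t) ?_ ?_ ?_
  · intro a ha
    simp only [Finset.mem_filter, Finset.mem_univ, true_and] at ha
    simp only [Set.mem_toFinset, Set.mem_ofPred_eq]
    have ha' : (a : F) * (a : F)⁻¹ = 1 := by simp
    rw [← ha]
    linear_combination -4 * ha'
  · intro a _ b _ h
    exact Units.ext (mul_left_cancel₀ h2F (by linear_combination h))
  · intro x h
    simp only [Set.mem_toFinset, Set.mem_ofPred_eq] at h
    refine ⟨Units.mk0 _ (hx x h), ?_, ?_⟩
    · simp only [Finset.mem_filter, Finset.mem_univ, true_and, Units.val_mk0]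
      have h1 : (t + x) * 2⁻¹ * ((t - x) * 2⁻¹) = 1 := by
        have : (2 : F) * 2⁻¹ = 1 := mul_inv_cancel₀ h2F
        linear_combination (-(2⁻¹) ^ 2) * h + (2 * 2⁻¹ + 1) * this
      rw [inv_eq_of_mul_eq_one_right h1]
      field_simp
      ring
    · simp only [Units.val_mk0]
      field_simp
      ring

lemma card_torus_trace_eq (h2F : (2 : F) ≠ 0) {δ : F} (hδ : ¬IsSquare δ) (t : F) :
    ((Finset.univ.filter fun s : torus δ => entry s.1 0 0 + entry s.1 1 1 = t).card : ℤ)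
      = 1 - quadraticChar F (t ^ 2 - 4) := by
  have hδ0 : δ ≠ 0 := by rintro rfl; exact hδ (IsSquare.zero)
  have : (1 : ℤ) - quadraticChar F (t ^ 2 - 4) = quadraticChar F (δ * (t ^ 2 - 4)) + 1 := by
    rw [map_mul, quadraticChar_neg_one_iff_not_isSquare.2 hδ]
    ring
  rw [this, ← quadraticChar_card_sqrts (ringChar_ne_two h2F)]
  congr 1
  refine Finset.card_bij (fun s _ => 2 * δ * entry s.1 1 0) ?_ ?_ ?_
  · rintro ⟨s, h1, h2⟩ ha
    simp only [Finset.mem_filter, Finset.mem_univ, true_and] at ha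
    simp only [Set.mem_toFinset, Set.mem_ofPred_eq]
    have hd := entry_det s
    rw [h1, h2] at hd
    rw [← ha, h1]
    linear_combination -4 * δ * hd
  · rintro ⟨s, h1, h2⟩ ha ⟨r, h3, h4⟩ hb h
    simp only [Finset.mem_filter, Finset.mem_univ, true_and] at ha hb
    have e : entry s 1 0 = entry r 1 0 := mul_left_cancel₀ (mul_ne_zero h2F hδ0) h
    have e' : entry s 1 1 = entry r 1 1 := by
      rw [h1] at ha
      rw [h3] at hb
      exact mul_left_cancel₀ h2F (by linear_combination ha - hb)
    exact Subtype.ext (ext_entries (by rw [h1, h3, e']) (by rw [h2, h4, e]) e e')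
  · intro x h
    simp only [Set.mem_toFinset, Set.mem_ofPred_eq] at h
    refine ⟨⟨ofEntries (t * 2⁻¹) (δ * (x * (2 * δ)⁻¹)) (x * (2 * δ)⁻¹) (t * 2⁻¹) ?_, ?_⟩, ?_, ?_⟩
    · field_simp
      linear_combination -h
    · simp [mem_torus]
    · simp only [Finset.mem_filter, Finset.mem_univ, true_and, entry_ofEntries_zero_zero,
        entry_ofEntries_one_one]
      field_simp
      ring
    · simp only [entry_ofEntries_one_zero]
      field_simp

lemma sum_tori_apply_trace (h2F : (2 : F) ≠ 0) {δ : F} (hδ : ¬IsSquare δ)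
    (G : F → ℂ) :
    ∑ a : Fˣ, G ((a : F) + (a : F)⁻¹) + ∑ s : torus δ, G (entry s.1 0 0 + entry s.1 1 1)
      = 2 * ∑ t, G t := by
  rw [← Finset.sum_fiberwise' Finset.univ (fun a : Fˣ => (a : F) + (a : F)⁻¹),
    ← Finset.sum_fiberwise' Finset.univ (fun s : torus δ => entry s.1 0 0 + entry s.1 1 1),
    ← Finset.sum_add_distrib, Finset.mul_sum]
  refine Finset.sum_congr rfl fun t _ => ?_
  rw [Finset.sum_const, Finset.sum_const, ← add_nsmul, nsmul_eq_mul]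
  congr 1
  have := congrArg₂ (· + ·) (card_add_inv_eq h2F t) (card_torus_trace_eq h2F hδ t)
  ring_nf at this
  exact_mod_cast this


lemma sum_diag_add_sum_torus (h2F : (2 : F) ≠ 0) (hf : ∀ g h, f (h * g * h⁻¹) = f g)
    (hneg : ∀ g, f (-g) = f g) {δ : F} (hδ : ¬IsSquare δ) :
    ∑ a : Fˣ, f (diag a) + ∑ s : torus δ, f s - 4 * f 1
      = 2 * (∑ t, f (bigCell 1 0 t) - f (bigCell 1 0 2) - f (bigCell 1 0 (-2))) := by
  have hδ0 : δ ≠ 0 := by rintro rfl; exact hδ (IsSquare.zero)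
  have h22 : (2 : F) ≠ -2 := fun h => h2F (by
    have : (2 : F) * 2 = 0 := by linear_combination h
    simpa using this)
  have h11 : (1 : F) ≠ -1 := fun h => h22 (by linear_combination 2 * h)
  have h11' : (1 : Fˣ) ≠ -1 := fun h => h11 (congrArg Units.val h)
  have h11s : (1 : torus δ) ≠ ⟨-1, neg_one_mem_torus δ⟩ := fun h =>
    h11 (congrArg (fun s : torus δ => entry s.1 0 0) h)
  have hfneg : f (-1) = f 1 := hneg 1
  set G : F → ℂ := fun t => f (bigCell 1 0 t) with hG
  have key := sum_tori_apply_trace h2F hδ G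
  have e1 : ∑ a : Fˣ, (f (diag a) - G ((a : F) + (a : F)⁻¹)) = 2 * f 1 - (G 2 + G (-2)) := by
    have h2 : (1 : F) + 1 = 2 := by norm_num
    have h2' : (-1 : F) + -1 = -2 := by norm_num
    rw [Fintype.sum_eq_add (1 : Fˣ) (-1) h11']
    · rw [diag_neg_one, map_one, hfneg]
      push_cast
      rw [inv_neg_one, inv_one, h2, h2']
      ring
    · rintro a ⟨h1, h2⟩
      rw [apply_diag hf h1 h2, sub_self]
  have e2 : ∑ s : torus δ, (f s - G (entry s.1 0 0 + entry s.1 1 1))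
      = 2 * f 1 - (G 2 + G (-2)) := by
    have h2 : (1 : F) + 1 = 2 := by norm_num
    have h2' : (-1 : F) + -1 = -2 := by norm_num
    rw [Fintype.sum_eq_add (1 : torus δ) ⟨-1, neg_one_mem_torus δ⟩ h11s]
    · simp only [Subgroup.coe_one, hfneg, entry_neg, entry_one_zero_zero, entry_one_one_one, h2, h2']
      ring
    · rintro ⟨s, hs⟩ ⟨h1, h2⟩
      have h1' : s ≠ 1 := fun h => h1 (Subtype.ext h)
      have h2' : s ≠ -1 := fun h => h2 (Subtype.ext h)
      rw [apply_eq_companion h2F hf s (entry_one_zero_ne_zero hs h1' h2')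
        (trace_sq_ne_four h2F hδ0 hs h1' h2'), sub_self]
  rw [Finset.sum_sub_distrib] at e1 e2
  linear_combination e1 + e2 + key

lemma card_torus (h2F : (2 : F) ≠ 0) {δ : F} (hδ : ¬IsSquare δ) :
    Fintype.card (torus δ) = Fintype.card F + 1 := by
  have := sum_diag_add_sum_torus (f := fun _ => 1) h2F (fun _ _ => rfl) (fun _ => rfl) hδ
  simp only [Finset.sum_const, Finset.card_univ, nsmul_eq_mul, natCast_card_units] at this
  have h : (Fintype.card (torus δ) : ℂ) = Fintype.card F + 1 := by linear_combination this
  exact_mod_cast h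

lemma sum_borel (h2F : (2 : F) ≠ 0) (hf : ∀ g h, f (h * g * h⁻¹) = f g)
    (hneg : ∀ g, f (-g) = f g) :
    ∑ a, ∑ b, f (borel a b)
      = Fintype.card F * (∑ a, f (diag a) - 2 * f 1) + 2 * ∑ x, f (upper x) := by
  have h11 : (1 : Fˣ) ≠ -1 := fun h => h2F (by
    have := congrArg Units.val h
    push_cast at this
    linear_combination this)
  have e : ∑ a, (∑ b, f (borel a b) - Fintype.card F * f (diag a))
      = 2 * ∑ x, f (upper x) - 2 * Fintype.card F * f 1 := by
    rw [Fintype.sum_eq_add (1 : Fˣ) (-1) h11]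
    · simp only [borel_one, borel_neg_one, hneg, diag_neg_one, map_one]
      rw [← Equiv.sum_comp (Equiv.neg F) fun x => f (upper x)]
      simp only [Equiv.neg_apply]
      rw [← Equiv.sum_comp (Equiv.neg F) fun x => f (upper (-x))]
      simp only [Equiv.neg_apply, neg_neg]
      ring
    · rintro a ⟨h1, h2⟩
      simp [apply_borel hf h1 h2]
  rw [Finset.sum_sub_distrib, ← Finset.mul_sum] at e
  linear_combination e

lemma sum_bigCell (h2F : (2 : F) ≠ 0) (hf : ∀ g h, f (h * g * h⁻¹) = f g)
    (hneg : ∀ g, f (-g) = f g) :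
    ∑ c, ∑ t, f (bigCell c 0 t) = 2 * ∑ x : Fˣ, f (upper x) + (Fintype.card F - 1) *
      (∑ t, f (bigCell 1 0 t) - f (bigCell 1 0 2) - f (bigCell 1 0 (-2))) := by
  have h22 : (2 : F) ≠ -2 := fun h => h2F (by
    have : (2 : F) * 2 = 0 := by linear_combination h
    simpa using this)
  have e : ∑ t, (∑ c, f (bigCell c 0 t) - (Fintype.card F - 1) * f (bigCell 1 0 t))
      = 2 * ∑ x : Fˣ, f (upper x)
        - (Fintype.card F - 1) * (f (bigCell 1 0 2) + f (bigCell 1 0 (-2))) := by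
    rw [Fintype.sum_eq_add (2 : F) (-2) h22]
    · simp only [apply_companion_two hf, bigCell_neg_two, hneg]
      rw [← Equiv.sum_comp (Equiv.neg Fˣ) fun x => f (upper x)]
      simp only [Equiv.neg_apply, Units.val_neg, neg_neg]
      rw [← Equiv.sum_comp (Equiv.neg Fˣ) fun x => f (upper x)]
      simp only [Equiv.neg_apply, Units.val_neg]
      ring
    · rintro t ⟨h1, h2⟩
      have ht : t ^ 2 ≠ 4 := fun h => (sq_eq_four_iff.1 h).elim h1 h2
      have hc (c : Fˣ) : f (bigCell c 0 t) = f (bigCell 1 0 t) := by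
        have := apply_eq_companion h2F hf (bigCell c 0 t) c.ne_zero (by simpa [bigCell] using ht)
        simpa [bigCell] using this
      simp [hc, ← natCast_card_units]
  rw [Finset.sum_sub_distrib, ← Finset.mul_sum, Finset.sum_comm] at e
  linear_combination e

/-- The sum of an even class function over `SL₂`. -/
theorem sum_eq (h2F : (2 : F) ≠ 0) (hf : ∀ g h, f (h * g * h⁻¹) = f g)
    (hneg : ∀ g, f (-g) = f g) {δ : F} (hδ : ¬IsSquare δ) :
    2 * ∑ g, f g = 4 * (f 1 + (Fintype.card F + 1) * ∑ x : Fˣ, f (upper x))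
      + Fintype.card F * (Fintype.card F + 1) * (∑ a, f (diag a) - 2 * f 1)
      + Fintype.card F * (Fintype.card F - 1) * (∑ s : torus δ, f s - 2 * f 1) := by
  have hd (c : Fˣ) : ∑ a, ∑ d, f (bigCell c a d) = Fintype.card F * ∑ t, f (bigCell c 0 t) := by
    have (a : F) : ∑ d, f (bigCell c a d) = ∑ t, f (bigCell c 0 t) := by
      rw [← Equiv.sum_comp (Equiv.addLeft a) fun t => f (bigCell c 0 t)]
      exact Finset.sum_congr rfl fun d _ => apply_bigCell hf c a d
    simp [this]
  rw [← (Equiv.ofBijective _ (ofCells_bijective (F := F))).sum_comp, Fintype.sum_sum_type,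
    Fintype.sum_prod_type, Fintype.sum_prod_type]
  simp only [Fintype.sum_prod_type, Equiv.ofBijective_apply, ofCells, hd]
  rw [sum_borel h2F hf hneg, ← Finset.mul_sum, sum_bigCell h2F hf hneg,
    sum_eq_zero_add_sum_units fun x => f (upper x), upper_zero]
  linear_combination -Fintype.card F * (Fintype.card F - 1)
    * sum_diag_add_sum_torus h2F hf hneg hδ

end SL2
end Summation

section Profile

open Matrix

lemma conj_character_eq_inv {G V : Type} [Group G] [Finite G] [AddCommGroup V] [Module ℂ V]
    [FiniteDimensional ℂ V] (ρ : Representation ℂ G V) (g : G) :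
    (starRingEnd ℂ) (ρ.character g) = ρ.character g⁻¹ := by
  let : CommGroup (Subgroup.zpowers g) :=
    { (Subgroup.zpowers g).toGroup with mul_comm := mul_comm' }
  have := Fintype.ofFinite (Additive (Subgroup.zpowers g))
  obtain ⟨m, -, h⟩ := exists_multiplicities (A := Additive (Subgroup.zpowers g))
    (MonoidHom.comp ρ ((Subgroup.zpowers g).subtype.comp
      (MulEquiv.multiplicativeAdditive _).toMonoidHom))
  have h1 := h (Additive.ofMul ⟨g, Subgroup.mem_zpowers g⟩)
  have h2 := h (-Additive.ofMul ⟨g, Subgroup.mem_zpowers g⟩)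
  change ρ.character g = _ at h1
  change ρ.character g⁻¹ = _ at h2
  rw [h1, h2]
  simp [AddChar.map_neg_eq_conj]

namespace SL2

variable {F : Type} [Field F]

lemma units_neg_one_ne_one (h2F : (2 : F) ≠ 0) : (-1 : Fˣ) ≠ 1 := by
  intro h
  have h' : (-1 : F) = 1 := by simpa using congrArg Units.val h
  exact h2F (by linear_combination -h')

lemma torus_neg_one_ne_one {δ : F} (h2F : (2 : F) ≠ 0) : (⟨-1, neg_one_mem_torus δ⟩ : torus δ) ≠ 1 := by
  intro h
  have h' := congrArg (fun t : torus δ => entry t.1 0 0) h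
  simp only [entry_neg, Subgroup.coe_one, entry_one_zero_zero] at h'
  exact h2F (by linear_combination -h')

variable [Fintype F]

/-- The upper unitriangular subgroup as a homomorphism. -/
def upperHom : Multiplicative F →* SpecialLinearGroup (Fin 2) F where
  toFun x := upper x.toAdd
  map_one' := upper_zero
  map_mul' x y := upper_add x.toAdd y.toAdd

/-- The multiplicities of the additive characters in a restriction to the unipotent subgroup. -/
lemma exists_unipotent_multiplicities {V : Type} [AddCommGroup V] [Module ℂ V]
    [FiniteDimensional ℂ V] (ρ : Representation ℂ (SpecialLinearGroup (Fin 2) F) V)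
    (lam : AddChar F ℂ) (hlam : lam.IsPrimitive) :
    ∃ M : F → ℕ, (∀ x, ρ.character (upper x) = ∑ y, (M y : ℂ) * lam (y * x)) ∧
      (∀ t : Fˣ, ∀ y, M ((t : F) ^ 2 * y) = M y) ∧
      ∑ x, ρ.character (upper x) * (starRingEnd ℂ) (ρ.character (upper x))
        = Fintype.card F * ∑ y, (M y : ℂ) ^ 2 := by
  obtain ⟨m, h1, h2⟩ := exists_multiplicities (A := F) (MonoidHom.comp ρ upperHom)
  have hc (x : F) : Representation.character (MonoidHom.comp ρ upperHom) (Multiplicative.ofAdd x)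
    = ρ.character (upper x) := rfl
  simp only [hc] at h1 h2
  have hb : Function.Bijective (fun y : F => lam.mulShift y) := by
    rw [Fintype.bijective_iff_injective_and_card]
    exact ⟨AddChar.to_mulShift_inj_of_isPrimitive hlam, AddChar.card_eq.symm⟩
  refine ⟨fun y => m (lam.mulShift y), fun x => ?_, fun t y => ?_, ?_⟩
  · rw [h2, ← (Equiv.ofBijective _ hb).sum_comp]
    rfl
  · have hq : (Fintype.card F : ℂ) ≠ 0 := Nat.cast_ne_zero.2 Fintype.card_ne_zero
    have : (m (lam.mulShift ((t : F) ^ 2 * y)) : ℂ) = m (lam.mulShift y) := by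
      refine mul_left_cancel₀ hq ?_
      rw [h1, h1, ← Equiv.sum_comp (Units.mulLeft (t ^ 2))
        fun x => lam.mulShift y (-x) * ρ.character (upper x)]
      refine Finset.sum_congr rfl fun x _ => ?_
      rw [Units.mulLeft_apply, Units.val_pow_eq_pow_val, ← diag_conj_upper, Representation.char_conj,
        AddChar.mulShift_apply, AddChar.mulShift_apply]
      congr 2
      ring
    exact_mod_cast this
  · rw [sum_norm_sq_of_combination (fun β => (m β : ℂ)) _ h2, ← (Equiv.ofBijective _ hb).sum_comp]
    simp [sq]

variable [DecidableEq F]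

lemma apply_unit_eq {α : Type*} {M : F → α} {ε : F} (hε : ¬IsSquare ε)
    (hM : ∀ t : Fˣ, ∀ y, M ((t : F) ^ 2 * y) = M y) (y : Fˣ) :
    M y = if quadraticChar F y = 1 then M 1 else M ε := by
  have hε0 : ε ≠ 0 := by rintro rfl; exact hε IsSquare.zero
  by_cases hy : IsSquare (y : F)
  · rw [if_pos ((quadraticChar_one_iff_isSquare y.ne_zero).2 hy)]
    obtain ⟨r, hr⟩ := hy
    have hr0 : r ≠ 0 := by rintro rfl; simp at hr
    have h1 := hM (Units.mk0 r hr0) 1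
    rwa [Units.val_mk0, mul_one, sq, ← hr] at h1
  · have hy' := quadraticChar_neg_one_iff_not_isSquare.2 hy
    rw [if_neg (by rw [hy']; norm_num)]
    have h1 : quadraticChar F ((y : F) * ε) = 1 := by
      rw [map_mul, hy', quadraticChar_neg_one_iff_not_isSquare.2 hε]
      norm_num
    obtain ⟨r, hr⟩ := (quadraticChar_one_iff_isSquare (mul_ne_zero y.ne_zero hε0)).1 h1
    have hr0 : r ≠ 0 := by rintro rfl; simp [hε0] at hr
    have h2 := hM (Units.mk0 (r * ε⁻¹) (mul_ne_zero hr0 (inv_ne_zero hε0))) ε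
    have h3 : (r * ε⁻¹) ^ 2 * ε = y := by
      field_simp
      linear_combination -hr
    rwa [Units.val_mk0, h3] at h2

lemma two_mul_sum_units (h2F : (2 : F) ≠ 0) {M : F → ℂ} {ε : F} (hε : ¬IsSquare ε)
    (hM : ∀ t : Fˣ, ∀ y, M ((t : F) ^ 2 * y) = M y) :
    2 * ∑ y : Fˣ, M y = (Fintype.card F - 1) * (M 1 + M ε) := by
  have h (y : Fˣ) : 2 * M y = (M 1 + M ε) + (M 1 - M ε) * (quadraticChar F y : ℤ) := by
    rw [apply_unit_eq hε hM y]
    rcases quadraticChar_dichotomy y.ne_zero with h | h <;> rw [h]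
    · rw [if_pos rfl]
      push_cast
      ring
    · rw [if_neg (by norm_num)]
      push_cast
      ring
  have hs : ∑ y : Fˣ, quadraticChar F (y : F) = 0 := by
    have := quadraticChar_sum_zero (ringChar_ne_two h2F)
    rwa [sum_eq_zero_add_sum_units, MulChar.map_zero, zero_add] at this
  rw [Finset.mul_sum]
  simp only [h]
  rw [Finset.sum_add_distrib, ← Finset.mul_sum, ← Int.cast_sum, hs]
  simp only [Finset.sum_const, Finset.card_univ, nsmul_eq_mul, natCast_card_units]
  push_cast
  ring

/-- The restriction of a class function to the split torus, corrected at `1` and `-1`. -/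
noncomputable def splitPart (s : ℂ) (f : SpecialLinearGroup (Fin 2) F → ℂ)
    (t : Additive Fˣ) : ℂ :=
  f (diag t.toMul) - if t = 0 ∨ t = Additive.ofMul (-1) then s * ((Fintype.card F - 1) / 2) else 0

open scoped Classical in
/-- The negative of the restriction of a class function to the nonsplit torus, corrected at
`1` and `-1`. -/
noncomputable def nonsplitPart {δ : F} (s : ℂ) (f : SpecialLinearGroup (Fin 2) F → ℂ)
    (t : Additive (torus δ)) : ℂ :=
  (if t = 0 ∨ t = Additive.ofMul ⟨-1, neg_one_mem_torus δ⟩ then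
    s * ((Fintype.card F + 1) / 2) else 0) - f t.toMul

/-- The values of a character of `SL₂` trivial on `-1`. -/
structure IsProfile (δ : F) (f : SpecialLinearGroup (Fin 2) F → ℂ) (u a b : ℕ) (n k : ℤ) :
    Prop where
  conj_invariant : ∀ g h, f (h * g * h⁻¹) = f g
  even : ∀ g, f (-g) = f g
  conj_apply : ∀ g, (starRingEnd ℂ) (f g) = f g⁻¹
  apply_one : 2 * f 1 = 2 * u + (a + b) * (Fintype.card F - 1)
  sum_upper : 2 * ∑ x : Fˣ, f (upper x) = (Fintype.card F - 1) * (2 * u - (a + b))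
  sum_upper_sq : 2 * ∑ x : Fˣ, f (upper x) * (starRingEnd ℂ) (f (upper x))
    = Fintype.card F * (2 * u ^ 2 + (Fintype.card F - 1) * (a ^ 2 + b ^ 2)) - 2 * f 1 ^ 2
  apply_upper : a = b → ∀ x : Fˣ, f (upper x) = u - a
  split : IsVirtualCharacter (splitPart (a + b) f) u n
  nonsplit : IsVirtualCharacter (nonsplitPart (δ := δ) (a + b) f) (a + b - u) k

lemma exists_splitPart (h2F : (2 : F) ≠ 0) {V : Type} [AddCommGroup V] [Module ℂ V]
    [FiniteDimensional ℂ V] (ρ : Representation ℂ (SpecialLinearGroup (Fin 2) F) V) (s : ℕ) :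
    ∃ u n : ℤ, IsVirtualCharacter (splitPart s ρ.character) u n := by
  obtain ⟨m, -, hm⟩ := exists_multiplicities (A := Additive Fˣ)
    (MonoidHom.comp ρ (diag.comp (MulEquiv.multiplicativeAdditive _).toMonoidHom))
  have hz : Additive.ofMul (-1 : Fˣ) + Additive.ofMul (-1) = 0 := by
    rw [← ofMul_mul, neg_one_mul, neg_neg, ofMul_one]
  have hz0 : Additive.ofMul (-1 : Fˣ) ≠ 0 :=
    fun h => units_neg_one_ne_one h2F (Additive.ofMul.injective h)
  obtain ⟨u, n, hu⟩ := exists_isVirtualCharacter_sub_regular m hm hz hz0 s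
  have hcard : (Fintype.card (Additive Fˣ) : ℂ) = Fintype.card F - 1 := by
    rw [Fintype.card_congr Additive.toMul, natCast_card_units]
  refine ⟨u, n, ?_⟩
  convert hu using 2 with t
  rw [splitPart, hcard]
  rfl

lemma exists_nonsplitPart (h2F : (2 : F) ≠ 0) {δ : F} (hδ : ¬IsSquare δ) {V : Type}
    [AddCommGroup V] [Module ℂ V] [FiniteDimensional ℂ V]
    (ρ : Representation ℂ (SpecialLinearGroup (Fin 2) F) V) (s : ℕ) :
    ∃ u n : ℤ, IsVirtualCharacter (nonsplitPart (δ := δ) s ρ.character) u n := by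
  classical
  obtain ⟨m, -, hm⟩ := exists_multiplicities (A := Additive (torus δ))
    (MonoidHom.comp ρ ((torus δ).subtype.comp (MulEquiv.multiplicativeAdditive _).toMonoidHom))
  have hz : Additive.ofMul (⟨-1, neg_one_mem_torus δ⟩ : torus δ)
      + Additive.ofMul ⟨-1, neg_one_mem_torus δ⟩ = 0 := by
    rw [← ofMul_mul, ← ofMul_one]
    exact congrArg Additive.ofMul (Subtype.ext ((neg_one_mul _).trans (neg_neg _)))
  have hz0 : Additive.ofMul (⟨-1, neg_one_mem_torus δ⟩ : torus δ) ≠ 0 :=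
    fun h => torus_neg_one_ne_one h2F (Additive.ofMul.injective h)
  obtain ⟨u, n, hu⟩ := exists_isVirtualCharacter_sub_regular m hm hz hz0 s
  have hcard : (Fintype.card (Additive (torus δ)) : ℂ) = Fintype.card F + 1 := by
    rw [Fintype.card_congr Additive.toMul, card_torus h2F hδ]
    push_cast
    rfl
  refine ⟨-u, n, ?_⟩
  convert hu.neg using 2 with t
  rw [nonsplitPart, hcard, neg_sub]
  rfl

theorem exists_isProfile (h2F : (2 : F) ≠ 0) {δ : F} (hδ : ¬IsSquare δ)
    {V : Type} [AddCommGroup V] [Module ℂ V] [FiniteDimensional ℂ V]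
    (ρ : Representation ℂ (SpecialLinearGroup (Fin 2) F) V) (hρ : ρ (-1) = 1) :
    ∃ u a b n k, IsProfile δ ρ.character u a b n k := by
  let lam := (AddChar.FiniteField.primitiveChar_to_Complex F)
  have hlam : lam.IsPrimitive := AddChar.FiniteField.primitiveChar_to_Complex_isPrimitive F
  obtain ⟨M, hM1, hM2, hM3⟩ := exists_unipotent_multiplicities ρ lam hlam
  have hM2' (t : Fˣ) (y : F) : (M ((t : F) ^ 2 * y) : ℂ) = M y := by rw [hM2]
  have hsum := two_mul_sum_units h2F hδ (M := fun y => (M y : ℂ)) hM2'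
  have hsumsq := two_mul_sum_units h2F hδ (M := fun y => (M y : ℂ) ^ 2)
    fun t y => by rw [hM2]
  have hone : 2 * ρ.character 1 = 2 * M 0 + (M 1 + M δ) * (Fintype.card F - 1) := by
    rw [← upper_zero, hM1]
    simp only [mul_zero, AddChar.map_zero_eq_one, mul_one]
    rw [sum_eq_zero_add_sum_units]
    linear_combination hsum
  have heven (g) : ρ.character (-g) = ρ.character g := by
    rw [← neg_one_mul, Representation.character, map_mul, hρ, one_mul, Representation.character]
  have hconj (g) : (starRingEnd ℂ) (ρ.character g) = ρ.character g⁻¹ := conj_character_eq_inv ρ g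
  have hupper : ∑ x, ρ.character (upper x) = Fintype.card F * M 0 := by
    simp only [hM1]
    rw [Finset.sum_comm]
    simp only [← Finset.mul_sum]
    have (y : F) : ∑ x, lam (y * x) = if y = 0 then (Fintype.card F : ℂ) else 0 := by
      have := AddChar.sum_mulShift y hlam
      push_cast at this
      simpa only [mul_comm y] using this
    simp [this, mul_comm]
  obtain ⟨u, n, hs⟩ := exists_splitPart h2F ρ (M 1 + M δ)
  obtain ⟨u', k, hs'⟩ := exists_nonsplitPart h2F hδ ρ (M 1 + M δ)
  push_cast at hs hs'
  have hsu : u = M 0 := by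
    have := hs.apply_zero
    rw [splitPart, if_pos (.inl rfl), toMul_zero, map_one] at this
    have h : (u : ℂ) = (M 0 : ℕ) := by linear_combination -this + hone / 2
    exact_mod_cast h
  have hsu' : u' = M 1 + M δ - M 0 := by
    have := hs'.apply_zero
    rw [nonsplitPart, if_pos (.inl rfl), toMul_zero, Subgroup.coe_one] at this
    have h : ((u' : ℤ) : ℂ) = (M 1 : ℕ) + (M δ : ℕ) - (M 0 : ℕ) := by
      linear_combination -this - hone / 2
    exact_mod_cast h
  refine ⟨M 0, M 1, M δ, n, k, fun g h => ρ.char_conj g h, heven, hconj, hone, ?_, ?_, ?_, ?_, ?_⟩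
  · rw [sum_eq_zero_add_sum_units, upper_zero] at hupper
    linear_combination 2 * hupper - hone
  · rw [sum_eq_zero_add_sum_units, upper_zero, sum_eq_zero_add_sum_units (fun y => (M y : ℂ) ^ 2),
      hconj, inv_one] at hM3
    linear_combination 2 * hM3 + Fintype.card F * hsumsq
  · intro hab x
    have hMy (y : Fˣ) : M y = M 1 := by rw [apply_unit_eq hδ hM2 y, ← hab, ite_self]
    rw [hM1, sum_eq_zero_add_sum_units]
    simp only [hMy, ← Finset.mul_sum]
    have := AddChar.sum_mulShift (x : F) hlam
    rw [if_neg x.ne_zero, sum_eq_zero_add_sum_units] at this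
    simp only [zero_mul, AddChar.map_zero_eq_one] at this ⊢
    push_cast at this
    linear_combination (M 1 : ℂ) * this
  · rwa [hsu] at hs
  · rwa [hsu'] at hs'

end SL2
end Profile

section ProfileSums

open Matrix

namespace SL2.IsProfile

variable {F : Type} [Field F] [Fintype F] [DecidableEq F] {δ : F}
  {f g : SpecialLinearGroup (Fin 2) F → ℂ} {u a b v c d : ℕ} {n k l m : ℤ}

lemma splitPart_zero (hf : IsProfile δ f u a b n k) : splitPart (a + b) f 0 = u := by
  simpa using hf.split.apply_zero

lemma splitPart_neg_one (hf : IsProfile δ f u a b n k) :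
    splitPart (a + b) f (Additive.ofMul (-1)) = u := by
  rw [← hf.splitPart_zero, splitPart, splitPart, if_pos (.inr rfl), if_pos (.inl rfl)]
  change f (diag (-1)) - _ = f (diag 1) - _
  rw [diag_neg_one, map_one, hf.even]

lemma nonsplitPart_zero (hf : IsProfile δ f u a b n k) :
    nonsplitPart (δ := δ) (a + b) f 0 = a + b - u := by
  simpa using hf.nonsplit.apply_zero

lemma nonsplitPart_neg_one (hf : IsProfile δ f u a b n k) :
    nonsplitPart (a + b) f (Additive.ofMul ⟨-1, neg_one_mem_torus δ⟩) = a + b - u := by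
  rw [← hf.nonsplitPart_zero, nonsplitPart, nonsplitPart, if_pos (.inr rfl), if_pos (.inl rfl)]
  change _ - f (-1) = _ - f 1
  rw [hf.even]

lemma splitPart_of_ne {s : ℂ} {t : Fˣ} (h1 : t ≠ 1) (h2 : t ≠ -1) :
    splitPart s f (Additive.ofMul t) = f (diag t) := by
  rw [splitPart, if_neg, sub_zero]
  · rfl
  · rintro (h | h)
    exacts [h1 (Additive.ofMul.injective h), h2 (Additive.ofMul.injective h)]

lemma nonsplitPart_of_ne {s : ℂ} {t : torus δ} (h1 : t ≠ 1)
    (h2 : t ≠ ⟨-1, neg_one_mem_torus δ⟩) :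
    nonsplitPart s f (Additive.ofMul t) = -f t := by
  rw [nonsplitPart, if_neg, zero_sub]
  · rfl
  · rintro (h | h)
    exacts [h1 (Additive.ofMul.injective h), h2 (Additive.ofMul.injective h)]

/-- Replacing functions on the split torus by their reduced parts only affects `1` and `-1`. -/
lemma sum_diag (h2F : (2 : F) ≠ 0) (hf : IsProfile δ f u a b n k) (hg : IsProfile δ g v c d l m)
    (P : ℂ → ℂ → ℂ) :
    ∑ t : Fˣ, P (f (diag t)) (g (diag t)) =
      ∑ t, P (splitPart (a + b) f t) (splitPart (c + d) g t) + 2 * (P (f 1) (g 1) - P u v) := by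
  rw [← sub_eq_iff_eq_add', ← Additive.ofMul.sum_comp, ← Finset.sum_sub_distrib,
    Fintype.sum_eq_add 1 (-1) (units_neg_one_ne_one h2F).symm]
  · rw [ofMul_one, hf.splitPart_zero, hg.splitPart_zero, hf.splitPart_neg_one,
      hg.splitPart_neg_one, diag_neg_one, map_one, hf.even, hg.even]
    ring
  · rintro t ⟨h1, h2⟩
    rw [splitPart_of_ne h1 h2, splitPart_of_ne h1 h2, sub_self]

/-- Replacing functions on the nonsplit torus by their reduced parts only affects `1` and `-1`. -/
lemma sum_torus (h2F : (2 : F) ≠ 0) (hf : IsProfile δ f u a b n k)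
    (hg : IsProfile δ g v c d l m) (P : ℂ → ℂ → ℂ) :
    ∑ t : torus δ, P (f t) (g t) =
      ∑ t : Additive (torus δ), P (-nonsplitPart (a + b) f t) (-nonsplitPart (c + d) g t)
        + 2 * (P (f 1) (g 1) - P (u - (a + b)) (v - (c + d))) := by
  rw [← sub_eq_iff_eq_add', ← Additive.ofMul.sum_comp, ← Finset.sum_sub_distrib,
    Fintype.sum_eq_add 1 ⟨-1, neg_one_mem_torus δ⟩ (torus_neg_one_ne_one h2F).symm]
  · rw [ofMul_one, hf.nonsplitPart_zero, hg.nonsplitPart_zero, hf.nonsplitPart_neg_one,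
      hg.nonsplitPart_neg_one, Subgroup.coe_one, hf.even, hg.even]
    simp only [neg_sub]
    ring
  · rintro t ⟨h1, h2⟩
    rw [nonsplitPart_of_ne h1 h2, nonsplitPart_of_ne h1 h2, neg_neg, neg_neg, sub_self]

lemma two_mul_sum (h2F : (2 : F) ≠ 0) (hδ : ¬IsSquare δ) (hf : IsProfile δ f u a b n k)
    (hg : IsProfile δ g v c d l m) (P : ℂ → ℂ → ℂ) :
    2 * ∑ x, P (f x) (g x) =
      4 * (P (f 1) (g 1) + (Fintype.card F + 1) * ∑ x : Fˣ, P (f (upper x)) (g (upper x)))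
      + Fintype.card F * (Fintype.card F + 1)
        * (∑ t, P (splitPart (a + b) f t) (splitPart (c + d) g t) - 2 * P u v)
      + Fintype.card F * (Fintype.card F - 1)
        * (∑ t : Additive (torus δ), P (-nonsplitPart (a + b) f t) (-nonsplitPart (c + d) g t)
          - 2 * P (u - (a + b)) (v - (c + d))) := by
  rw [sum_eq (f := fun x => P (f x) (g x)) h2F
    (fun x h => by rw [hf.conj_invariant, hg.conj_invariant])
    (fun x => by rw [hf.even, hg.even]) hδ, sum_diag h2F hf hg, sum_torus h2F hf hg]
  ring

lemma card_additive_units : (Fintype.card (Additive Fˣ) : ℂ) = Fintype.card F - 1 := by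
  rw [Fintype.card_congr Additive.toMul, natCast_card_units]

lemma card_additive_torus (h2F : (2 : F) ≠ 0) (hδ : ¬IsSquare δ) :
    (Fintype.card (Additive (torus δ)) : ℂ) = Fintype.card F + 1 := by
  rw [Fintype.card_congr Additive.toMul, card_torus h2F hδ]
  push_cast
  rfl

lemma conj_apply_one (hf : IsProfile δ f u a b n k) : (starRingEnd ℂ) (f 1) = f 1 := by
  rw [hf.conj_apply, inv_one]

lemma sum_norm_sq (h2F : (2 : F) ≠ 0) (hδ : ¬IsSquare δ) (hf : IsProfile δ f u a b n k) :
    2 * ∑ x, f x * (starRingEnd ℂ) (f x) =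
      Fintype.card F * (Fintype.card F ^ 2 - 1) * (n + k + (a - b) ^ 2) := by
  rw [two_mul_sum h2F hδ hf hf fun x y => x * (starRingEnd ℂ) y]
  simp only [map_neg, neg_mul_neg]
  rw [hf.split.sum_norm_sq, hf.nonsplit.sum_norm_sq, card_additive_units,
    card_additive_torus h2F hδ, hf.conj_apply_one]
  simp only [map_sub, map_add, map_natCast]
  have h1 := hf.apply_one
  have h2 := hf.sum_upper_sq
  have h1' : f 1 = u + (a + b) * (Fintype.card F - 1) / 2 := by linear_combination h1 / 2
  rw [h1'] at h2 ⊢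
  linear_combination 2 * (Fintype.card F + 1 : ℂ) * h2

lemma two_mul_sum_apply (h2F : (2 : F) ≠ 0) (hδ : ¬IsSquare δ) (hf : IsProfile δ f u a b n k) :
    2 * ∑ x, f x = Fintype.card F * (Fintype.card F + 1) * ∑ t, splitPart (a + b) f t
      - Fintype.card F * (Fintype.card F - 1)
        * ∑ t : Additive (torus δ), nonsplitPart (a + b) f t := by
  rw [two_mul_sum h2F hδ hf hf fun x _ => x, Finset.sum_neg_distrib]
  linear_combination 2 * hf.apply_one + 2 * (Fintype.card F + 1) * hf.sum_upper

lemma two_mul_sum_sq_mul_conj (h2F : (2 : F) ≠ 0) (hδ : ¬IsSquare δ)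
    (hf : IsProfile δ f u 1 1 n k) (hg : IsProfile δ g v c d l m) :
    2 * ∑ x, f x ^ 2 * (starRingEnd ℂ) (g x) =
      2 * Fintype.card F * (Fintype.card F ^ 2 - 1) * (c + d)
      + Fintype.card F * (Fintype.card F + 1)
        * ∑ t, splitPart 2 f t ^ 2 * (starRingEnd ℂ) (splitPart (c + d) g t)
      - Fintype.card F * (Fintype.card F - 1)
        * ∑ t : Additive (torus δ),
          nonsplitPart 2 f t ^ 2 * (starRingEnd ℂ) (nonsplitPart (c + d) g t) := by
  rw [two_mul_sum h2F hδ hf hg fun x y => x ^ 2 * (starRingEnd ℂ) y]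
  have h2 : ((1 : ℕ) : ℂ) + (1 : ℕ) = 2 := by norm_num
  have hsum : 2 * ∑ x : Fˣ, (starRingEnd ℂ) (g (upper x))
      = (Fintype.card F - 1) * (2 * v - (c + d)) := by
    have := congrArg (starRingEnd ℂ) hg.sum_upper
    simpa only [map_mul, map_sub, map_add, map_sum, map_natCast, map_one, map_ofNat] using this
  have hf1 : f 1 = u + (Fintype.card F - 1) := by
    have := hf.apply_one
    rw [h2] at this
    linear_combination this / 2
  simp only [hf.apply_upper rfl, ← Finset.mul_sum, map_neg, neg_sq, mul_neg,
    Finset.sum_neg_distrib, hg.conj_apply_one, h2, map_sub, map_add, map_natCast]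
  rw [hf1]
  push_cast
  linear_combination 2 * (Fintype.card F + 1) * (u - 1 : ℂ) ^ 2 * hsum
    + 2 * (u + (Fintype.card F - 1) : ℂ) ^ 2 * hg.apply_one

lemma apply_diag_inv (hf : IsProfile δ f u a b n k) (t : Fˣ) : f (diag t⁻¹) = f (diag t) := by
  by_cases h1 : t = 1
  · rw [h1, inv_one]
  by_cases h2 : t = -1
  · rw [h2, inv_neg, inv_one]
  rw [apply_diag hf.conj_invariant h1 h2, apply_diag hf.conj_invariant (inv_ne_one.2 h1)]
  · rw [Units.val_inv_eq_inv_val, inv_inv, add_comm]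
  · rwa [Ne, inv_eq_iff_eq_inv, inv_neg, inv_one]

lemma apply_torus_inv (h2F : (2 : F) ≠ 0) (hδ : ¬IsSquare δ) (hf : IsProfile δ f u a b n k)
    (t : torus δ) : f (t⁻¹ : torus δ) = f t := by
  have hδ0 : δ ≠ 0 := by rintro rfl; exact hδ IsSquare.zero
  obtain ⟨t, ht⟩ := t
  change f t⁻¹ = f t
  by_cases h1 : t = 1
  · rw [h1, inv_one]
  by_cases h2 : t = -1
  · rw [← hf.even t, h2, neg_neg, ← hf.even]
    congr 1
    rw [neg_eq_iff_eq_neg, inv_eq_iff_eq_inv, inv_neg]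
    simp
  have hc := entry_one_zero_ne_zero ht h1 h2
  have htr := trace_sq_ne_four h2F hδ0 ht h1 h2
  rw [apply_eq_companion h2F hf.conj_invariant t hc htr, inv_eq_ofEntries,
    apply_eq_companion h2F hf.conj_invariant]
  · simp [add_comm]
  · simpa using hc
  · simpa [add_comm] using htr

lemma conj_splitPart (hf : IsProfile δ f u a b n k) (t : Additive Fˣ) :
    (starRingEnd ℂ) (splitPart (a + b) f t) = splitPart (a + b) f t := by
  rw [hf.split.conj_apply, splitPart, splitPart, toMul_neg, hf.apply_diag_inv]
  simp only [neg_eq_iff_eq_neg, neg_zero, ← ofMul_inv, inv_neg, inv_one]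

lemma conj_nonsplitPart (h2F : (2 : F) ≠ 0) (hδ : ¬IsSquare δ) (hf : IsProfile δ f u a b n k)
    (t : Additive (torus δ)) :
    (starRingEnd ℂ) (nonsplitPart (a + b) f t) = nonsplitPart (a + b) f t := by
  have h : (⟨-1, neg_one_mem_torus δ⟩ : torus δ)⁻¹ = ⟨-1, neg_one_mem_torus δ⟩ :=
    inv_eq_of_mul_eq_one_left (Subtype.ext ((neg_one_mul _).trans (neg_neg _)))
  rw [hf.nonsplit.conj_apply, nonsplitPart, nonsplitPart, toMul_neg, hf.apply_torus_inv h2F hδ]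
  simp only [neg_eq_iff_eq_neg, neg_zero, ← ofMul_inv, h]

end SL2.IsProfile
end ProfileSums

section SquareCover

open Matrix

namespace SL2.IsProfile

variable {F : Type} [Field F] [Fintype F] [DecidableEq F] {δ : F}
  {f g : SpecialLinearGroup (Fin 2) F → ℂ} {u a b v c d : ℕ} {n k l m : ℤ}

lemma le_split (hf : IsProfile δ f u a b n k) : (u : ℤ) ≤ n :=
  (le_abs_self _).trans hf.split.abs_le

lemma le_nonsplit (hf : IsProfile δ f u a b n k) : (a + b - u : ℤ) ≤ k :=
  (le_abs_self _).trans hf.nonsplit.abs_le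

lemma split_add_nonsplit_le (hf : IsProfile δ f u a b n k)
    (hnorm : n + k + ((a : ℤ) - b) ^ 2 = 2) (hab : 0 < a + b) : n + k ≤ a + b := by
  have h1 := hf.le_split
  have h2 := hf.le_nonsplit
  rcases eq_or_ne a b with rfl | h
  · rw [sub_self] at hnorm
    omega
  · have h3 : 0 < ((a : ℤ) - b) ^ 2 := by
      have : (a : ℤ) - b ≠ 0 := sub_ne_zero.2 (by exact_mod_cast h)
      positivity
    omega

lemma eq_of_apply_one (hq : 9 ≤ Fintype.card F) (hf : IsProfile δ f u a b n k)
    (hnorm : n + k + ((a : ℤ) - b) ^ 2 = 2) {e : ℕ} (he : e ≤ 2)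
    (hdeg : f 1 = Fintype.card F - 1 + e) :
    a = 1 ∧ b = 1 ∧ u = e ∧ n = u ∧ k = 2 - u := by
  have h1 := hf.le_split
  have h2 := hf.le_nonsplit
  have h3 := hf.split.nonneg
  have h4 := hf.nonsplit.nonneg
  have h5 := sq_nonneg ((a : ℤ) - b)
  have h6 := hf.apply_one
  have h7 : 2 * ((Fintype.card F : ℤ) - 1 + e) = 2 * u + (a + b) * ((Fintype.card F : ℤ) - 1) := by
    rw [hdeg] at h6
    exact_mod_cast h6
  have ha : a ≤ 2 := by omega
  have hb : b ≤ 2 := by omega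
  interval_cases a <;> interval_cases b <;> norm_num at hnorm h7 h2 ⊢ <;> omega

/-- In the case `q ≡ 1 mod 4`, the reduced part of a character of degree `q - 1` has no zeros on
the nonsplit torus. -/
lemma nonsplitPart_ne_zero (h2F : (2 : F) ≠ 0) (hδ : ¬IsSquare δ)
    (hq : Fintype.card F % 4 = 1) (hf : IsProfile δ f 0 1 1 n 2) (t : Additive (torus δ)) :
    nonsplitPart 2 f t ≠ 0 := by
  have h := hf.nonsplit
  norm_num at h
  have hz := hf.nonsplitPart_neg_one
  norm_num at hz
  refine h.ne_zero_of_odd (z := Additive.ofMul ⟨-1, neg_one_mem_torus δ⟩)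
    (N := (Fintype.card F + 1) / 2) ?_ hz ?_ ?_
  · rw [← ofMul_mul, ← ofMul_one]
    exact congrArg Additive.ofMul (Subtype.ext ((neg_one_mul _).trans (neg_neg _)))
  · rw [Nat.odd_iff]
    omega
  · set y := ((Fintype.card F + 1) / 2) • t with hy
    have h1 : y + y = 0 := by
      rw [← two_nsmul, hy, ← mul_nsmul', ← card_nsmul_eq_zero (x := t),
        Fintype.card_congr Additive.toMul, card_torus h2F hδ]
      congr 1
      omega
    have h2 : (y.toMul : SpecialLinearGroup (Fin 2) F) * y.toMul = 1 :=
      congrArg (fun s : Additive (torus δ) => (s.toMul : SpecialLinearGroup (Fin 2) F)) h1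
    rcases eq_one_or_neg_one_of_sq_eq_one h2F y.toMul.2 h2 with h | h
    · left
      exact Additive.toMul.injective (Subtype.ext h)
    · right
      exact Additive.toMul.injective (Subtype.ext h)

theorem sum_sq_mul_conj_ne_zero (h2F : (2 : F) ≠ 0) (hδ : ¬IsSquare δ)
    (hq : Fintype.card F % 4 = 1) (hf : IsProfile δ f u 1 1 u (2 - u)) (hu : u ≤ 2)
    (hg : IsProfile δ g v c d l m) (hnorm : l + m + ((c : ℤ) - d) ^ 2 = 2) (hcd : 0 < c + d)
    (hinv : 0 ≤ (∑ x, g x).re) : ∑ x, f x ^ 2 * (starRingEnd ℂ) (g x) ≠ 0 := by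
  intro h0
  have hlm : (l + m : ℝ) ≤ c + d := by exact_mod_cast hg.split_add_nonsplit_le hnorm hcd
  have hcd' : (0 : ℝ) < c + d := by exact_mod_cast hcd
  have hl : (0 : ℝ) ≤ l := by exact_mod_cast hg.split.nonneg
  have hm : (0 : ℝ) ≤ m := by exact_mod_cast hg.nonsplit.nonneg
  have hQ : (1 : ℝ) < Fintype.card F := by exact_mod_cast Fintype.one_lt_card
  have hs := hf.split
  have hs' := hf.nonsplit
  simp only [Nat.cast_one, one_add_one_eq_two] at hs hs'
  have hc1 : (Fintype.card (Additive Fˣ) : ℝ) = Fintype.card F - 1 := by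
    exact_mod_cast congrArg Complex.re (card_additive_units (F := F))
  have hc2 : (Fintype.card (Additive (torus δ)) : ℝ) = Fintype.card F + 1 := by
    exact_mod_cast congrArg Complex.re (card_additive_torus h2F hδ)
  have hE := two_mul_sum_sq_mul_conj h2F hδ hf hg
  have hT := hs.sq_mul_add_le hg.split
  have hS := hs'.re_sum_sq_mul_conj_le hg.nonsplit
  rw [h0] at hE
  set T := ∑ t, splitPart 2 f t ^ 2 * (starRingEnd ℂ) (splitPart (c + d) g t) with hTdef
  set S := ∑ t : Additive (torus δ),
    nonsplitPart 2 f t ^ 2 * (starRingEnd ℂ) (nonsplitPart (c + d) g t) with hSdef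
  have hre : 2 * ((Fintype.card F : ℝ) ^ 2 - 1) * (c + d) + (Fintype.card F + 1) * T.re
      - (Fintype.card F - 1) * S.re = 0 := by
    have hQ0 : (Fintype.card F : ℂ) ≠ 0 := Nat.cast_ne_zero.2 Fintype.card_ne_zero
    have h1 : ((2 * ((Fintype.card F : ℝ) ^ 2 - 1) * (c + d) : ℝ) : ℂ)
        + ((Fintype.card F + 1 : ℝ) : ℂ) * T - ((Fintype.card F - 1 : ℝ) : ℂ) * S = 0 := by
      refine mul_left_cancel₀ hQ0 ?_
      push_cast
      linear_combination -hE
    have h2 := congrArg Complex.re h1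
    rwa [Complex.sub_re, Complex.add_re, Complex.re_ofReal_mul, Complex.re_ofReal_mul,
      Complex.ofReal_re] at h2
  rw [hc1] at hT
  rw [hc2] at hS
  have hQ2 : (0 : ℝ) < (Fintype.card F : ℝ) ^ 2 - 1 := by nlinarith
  have hT' := mul_le_mul_of_nonneg_left hT (by linarith : (0 : ℝ) ≤ Fintype.card F + 1)
  have hS' := mul_le_mul_of_nonneg_left hS (by linarith : (0 : ℝ) ≤ Fintype.card F - 1)
  have hvl : (0 : ℝ) ≤ l + v := by positivity
  interval_cases u
  · have h1 := mul_pos hQ2 hcd'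
    have h2 : ((Fintype.card F : ℝ) ^ 2 - 1) * (c + d) ≤ (Fintype.card F ^ 2 - 1) * m := by
      push_cast at hT' hS'
      linarith
    have h3 : (c + d : ℝ) ≤ m := le_of_mul_le_mul_left h2 hQ2
    obtain rfl : l = 0 := by
      have : (l : ℝ) = 0 := by linarith
      exact_mod_cast this
    have h4 : m = c + d := by
      have : (m : ℝ) = c + d := by push_cast at hlm; linarith
      exact_mod_cast this
    have hT0 : T = 0 := Finset.sum_eq_zero fun t _ => by
      rw [hg.split.eq_zero, map_zero, mul_zero]
    have hS0 : m * ((Fintype.card F + 1) * 2) ≤ S.re := by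
      have h5 : (m : ℝ) = c + d := by exact_mod_cast h4
      rw [hT0, Complex.zero_re] at hre
      refine le_of_mul_le_mul_left (a := (Fintype.card F : ℝ) - 1) ?_ (by linarith)
      rw [h5]
      linarith
    have hφ (t : Additive (torus δ)) : (nonsplitPart (c + d) g t).re = m := by
      have h5 := hs'.re_sq_mul_conj_eq hg.nonsplit (by rw [hc2]; convert hS0 using 3; norm_num) t
      have h6 := hf.nonsplitPart_ne_zero h2F hδ hq t
      obtain ⟨x, hx⟩ := Complex.conj_eq_iff_real.1 (hf.conj_nonsplitPart h2F hδ t)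
      simp only [Nat.cast_one, one_add_one_eq_two] at hx
      rw [hx] at h5 h6
      have hx0 : x ≠ 0 := by exact_mod_cast h6
      rw [← Complex.ofReal_pow, Complex.re_ofReal_mul, Complex.conj_re, Complex.norm_real,
        Real.norm_eq_abs, sq_abs, mul_comm (m : ℝ)] at h5
      exact mul_left_cancel₀ (pow_ne_zero 2 hx0) h5
    have hg2 := hg.two_mul_sum_apply h2F hδ
    simp only [hg.split.eq_zero, Finset.sum_const_zero] at hg2
    have hg3 := congrArg Complex.re (show ((2 : ℝ) : ℂ) * ∑ x, g x
        = -((Fintype.card F * (Fintype.card F - 1) : ℝ) : ℂ)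
          * ∑ t : Additive (torus δ), nonsplitPart (c + d) g t by
      push_cast
      linear_combination hg2)
    rw [Complex.re_ofReal_mul, neg_mul, Complex.neg_re, Complex.re_ofReal_mul,
      Complex.re_sum Finset.univ (nonsplitPart _ _), Finset.sum_congr rfl fun t _ => hφ t,
      Finset.sum_const, Finset.card_univ, nsmul_eq_mul, hc2] at hg3
    have hmpos : (0 : ℝ) < m := by linarith
    have hpos : (0 : ℝ) < Fintype.card F * (Fintype.card F - 1) * ((Fintype.card F + 1) * m) := by
      have : (0 : ℝ) < Fintype.card F - 1 := by linarith
      positivity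
    linarith
  · have h1 := mul_pos hQ2 hcd'
    have h2 := mul_le_mul_of_nonneg_left hlm hQ2.le
    push_cast at hT' hS'
    have h3 : (0 : ℝ) ≤ (Fintype.card F + 1) * (l + v) := by positivity
    linarith
  · have h2 := mul_le_mul_of_nonneg_left hlm hQ2.le
    have h4 := mul_nonneg hQ2.le hm
    push_cast at hT' hS'
    have h3 : ((Fintype.card F : ℝ) + 1) * (l + v) ≤ 0 := by linarith
    have h5 : (l + v : ℝ) ≤ 0 := nonpos_of_mul_nonpos_right h3 (by linarith)
    have hv : (0 : ℝ) ≤ v := by positivity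
    have hl0 : (l : ℝ) = 0 := by linarith
    rw [hl0] at hT'
    have hv0 : (v : ℝ) = 0 := by linarith
    have h1 := mul_pos hQ2 hcd'
    simp only [hv0] at hT'
    linarith

end SL2.IsProfile
end SquareCover

section ProjectiveCharacters

open Matrix

lemma exists_sum_comp_eq_mul {K G : Type*} [Group K] [Group G] [Fintype K] [Fintype G]
    (π : K →* G) (hπ : Function.Surjective π) :
    ∃ c : ℕ, c ≠ 0 ∧ ∀ h : G → ℂ, ∑ x, h (π x) = c * ∑ y, h y := by
  classical
  refine ⟨(Finset.univ.filter fun x => π x = 1).card, ?_, fun h => ?_⟩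
  · exact (Finset.card_pos.2 ⟨1, by simp⟩).ne'
  · rw [← Finset.sum_fiberwise Finset.univ π fun x => h (π x), Finset.mul_sum]
    refine Finset.sum_congr rfl fun y _ => ?_
    rw [Finset.sum_congr rfl fun x hx => by rw [(Finset.mem_filter.1 hx).2], Finset.sum_const,
      nsmul_eq_mul, MonoidHom.card_fiber_eq_of_mem_range π (hπ y) (hπ 1)]

lemma sum_character_re_nonneg {G V : Type} [Group G] [Fintype G] [AddCommGroup V] [Module ℂ V]
    [FiniteDimensional ℂ V] (ρ : Representation ℂ G V) : 0 ≤ (∑ g, ρ.character g).re := by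
  have : Invertible (Nat.card G : ℂ) := invertibleOfNonzero (Nat.cast_ne_zero.2 Nat.card_pos.ne')
  have h := FDRep.average_char_eq_finrank_invariants (FDRep.of ρ)
  rw [inv_mul_eq_iff_eq_mul₀ (Nat.cast_ne_zero.2 Nat.card_pos.ne')] at h
  have h2 : ∑ g, ρ.character g
      = ((Nat.card G * Module.finrank ℂ (Representation.invariants (FDRep.of ρ).ρ) : ℕ) : ℂ) := by
    push_cast
    exact h
  rw [h2, Complex.natCast_re]
  positivity

lemma map_eq_one_of_finrank_le_one {G V : Type} [Group G] [AddCommGroup V] [Module ℂ V]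
    [FiniteDimensional ℂ V] (hG : commutator G = ⊤) (ρ : Representation ℂ G V)
    (hV : Module.finrank ℂ V ≤ 1) (g : G) : ρ g = 1 := by
  obtain ⟨v, hv⟩ := finrank_le_one_iff.1 hV
  have hcomm (A B : V →ₗ[ℂ] V) : A * B = B * A := by
    ext w
    obtain ⟨r, rfl⟩ := hv w
    obtain ⟨s, hs⟩ := hv (A v)
    obtain ⟨t, ht⟩ := hv (B v)
    simp only [Module.End.mul_apply, map_smul, ← hs, ← ht, smul_comm s t]
  have hker : commutator G ≤ MonoidHom.ker ρ := by
    rw [commutator_def, Subgroup.commutator_le]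
    intro x _ y _
    rw [MonoidHom.mem_ker, commutatorElement_def, map_mul, map_mul, map_mul, hcomm (ρ x),
      mul_assoc (ρ y), ← map_mul, mul_inv_cancel, map_one, mul_one, ← map_mul, mul_inv_cancel,
      map_one]
  rw [hG] at hker
  exact hker (Subgroup.mem_top g)

namespace SL2

variable {F : Type} [Field F]

lemma neg_one_mem_center :
    (-1 : SpecialLinearGroup (Fin 2) F) ∈ Subgroup.center (SpecialLinearGroup (Fin 2) F) := by
  rw [Subgroup.mem_center_iff]
  intro g
  rw [mul_neg, neg_mul, mul_one, one_mul]

variable [Fintype F] [DecidableEq F] {δ : F}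

lemma two_mul_card (h2F : (2 : F) ≠ 0) (hδ : ¬IsSquare δ) :
    2 * (Fintype.card (SpecialLinearGroup (Fin 2) F) : ℂ)
      = 2 * (Fintype.card F * (Fintype.card F ^ 2 - 1)) := by
  have h := sum_eq (f := fun _ => (1 : ℂ)) h2F (fun _ _ => rfl) (fun _ => rfl) hδ
  simp only [Finset.sum_const, Finset.card_univ, nsmul_eq_mul, mul_one, natCast_card_units,
    card_torus h2F hδ] at h
  rw [h]
  push_cast
  ring

lemma IsProfile.sum_sq_eq (h2F : (2 : F) ≠ 0) (hδ : ¬IsSquare δ)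
    {f : SpecialLinearGroup (Fin 2) F → ℂ} {u a : ℕ} {n k : ℤ} (hf : IsProfile δ f u a a n k) :
    ∑ x, f x ^ 2 = ∑ x, f x * (starRingEnd ℂ) (f x) := by
  refine mul_left_cancel₀ (two_ne_zero (α := ℂ)) ?_
  rw [two_mul_sum h2F hδ hf hf fun x _ => x ^ 2,
    two_mul_sum h2F hδ hf hf fun x y => x * (starRingEnd ℂ) y]
  simp only [hf.apply_upper rfl, map_neg, hf.conj_splitPart, hf.conj_nonsplitPart h2F hδ,
    hf.conj_apply_one, map_sub, map_add, map_natCast, sq]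

/-- The pullback to `SL₂` of an irreducible character of `PSL₂`. -/
lemma exists_isProfile_of_simple (h2F : (2 : F) ≠ 0) (hδ : ¬IsSquare δ)
    (V : FDRep ℂ (ProjectiveSpecialLinearGroup (Fin 2) F)) [CategoryTheory.Simple V] :
    ∃ u a b n k, IsProfile δ (fun x : SpecialLinearGroup (Fin 2) F => V.character x) u a b n k ∧
      n + k + ((a : ℤ) - b) ^ 2 = 2 ∧
      0 ≤ (∑ x : SpecialLinearGroup (Fin 2) F, V.character x).re ∧
      ∑ x : SpecialLinearGroup (Fin 2) F, V.character x * (starRingEnd ℂ) (V.character x) ≠ 0 := by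
  classical
  let π := QuotientGroup.mk' (Subgroup.center (SpecialLinearGroup (Fin 2) F))
  let ρ : Representation ℂ (SpecialLinearGroup (Fin 2) F) V := MonoidHom.comp V.ρ π
  have hρ : ρ (-1) = 1 := by
    have : π (-1) = 1 := (QuotientGroup.eq_one_iff _).2 neg_one_mem_center
    rw [MonoidHom.comp_apply, this, map_one]
  obtain ⟨u, a, b, n, k, h⟩ := exists_isProfile h2F hδ ρ hρ
  have hq : (Fintype.card F * (Fintype.card F ^ 2 - 1) : ℂ) ≠ 0 := by
    intro h0
    have h1 := two_mul_card h2F hδ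
    rw [h0, mul_zero] at h1
    simp at h1
  have hnorm : ∑ x : SpecialLinearGroup (Fin 2) F,
      V.character x * (starRingEnd ℂ) (V.character x)
        = Fintype.card (SpecialLinearGroup (Fin 2) F) := by
    have : Fintype (ProjectiveSpecialLinearGroup (Fin 2) F) := Fintype.ofFinite _
    have : Invertible (Nat.card (ProjectiveSpecialLinearGroup (Fin 2) F) : ℂ) :=
      invertibleOfNonzero (Nat.cast_ne_zero.2 Nat.card_pos.ne')
    have h1 := FDRep.char_orthonormal V V
    rw [if_pos ⟨CategoryTheory.Iso.refl V⟩,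
      inv_mul_eq_iff_eq_mul₀ (Nat.cast_ne_zero.2 Nat.card_pos.ne'), mul_one] at h1
    obtain ⟨c, -, hc⟩ := exists_sum_comp_eq_mul π (QuotientGroup.mk'_surjective _)
    have h2 := hc fun g => V.character g * (starRingEnd ℂ) (V.character g)
    have h3 := hc fun _ => 1
    have h4 (g) : (starRingEnd ℂ) (V.character g) = V.character g⁻¹ := conj_character_eq_inv V.ρ g
    simp only [h4] at h2
    simp only [Finset.sum_const, Finset.card_univ, nsmul_eq_mul, mul_one] at h3
    rw [h1, Nat.card_eq_fintype_card, ← h3, ← Finset.card_univ] at h2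
    simp only [h4]
    exact h2
  refine ⟨u, a, b, n, k, h, ?_, sum_character_re_nonneg ρ, ?_⟩
  · have h1 := h.sum_norm_sq h2F hδ
    have h2 : (Fintype.card F * (Fintype.card F ^ 2 - 1) : ℂ) * (n + k + ((a : ℂ) - b) ^ 2)
        = Fintype.card F * (Fintype.card F ^ 2 - 1) * 2 := by
      rw [← h1, mul_comm _ (2 : ℂ), ← two_mul_card h2F hδ, ← hnorm]
      rfl
    exact_mod_cast mul_left_cancel₀ hq h2
  · rw [hnorm]
    exact Nat.cast_ne_zero.2 Fintype.card_ne_zero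

end SL2
end ProjectiveCharacters

/-- For a prime power `q ≥ 9` with `q ≡ 1 (mod 4)` and `G = PSL₂(q)`, the square of any
irreducible character of degree `q - 1`, `q` or `q + 1` contains every irreducible
character of `G`. -/
theorem psl2_one_mod_four_square_covers
    (q : ℕ) (hq9 : 9 ≤ q) (hq : ∃ p n : ℕ, p.Prime ∧ 0 < n ∧ q = p ^ n) (hq4 : q % 4 = 1)
    (F : Type) [Field F] [Fintype F] (hF : Fintype.card F = q)
    (χ ψ : Matrix.ProjectiveSpecialLinearGroup (Fin 2) F → ℂ)
    (hχ : IsIrreducibleCharacter _ χ)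
    (hχdeg : χ 1 ∈ ({(q : ℂ) - 1, (q : ℂ), (q : ℂ) + 1} : Set ℂ))
    (hψ : IsIrreducibleCharacter _ ψ) :
    charInner (fun g => χ g ^ 2) ψ ≠ 0 := by
  classical
  subst hF
  obtain ⟨V, hV, rfl⟩ := hχ
  obtain ⟨W, hW, rfl⟩ := hψ
  have hchar : ringChar F ≠ 2 := fun h => by
    have := FiniteField.even_card_iff_char_two.1 h
    omega
  have h2F : (2 : F) ≠ 0 := Ring.two_ne_zero hchar
  obtain ⟨δ, hδ⟩ := FiniteField.exists_nonsquare hchar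
  have hδ0 : δ ≠ 0 := by rintro rfl; exact hδ IsSquare.zero
  have hperfect : commutator (Matrix.ProjectiveSpecialLinearGroup (Fin 2) F) = ⊤ := by
    refine SL2Simple.PSL_commutator_eq_top ⟨δ, hδ0, fun h => ?_⟩
    rcases sq_eq_one_iff.1 h with rfl | rfl
    · exact hδ IsSquare.one
    · exact hδ (FiniteField.isSquare_neg_one_iff.2 (by omega))
  obtain ⟨u, a, b, n, k, hf, hnorm, -, hne⟩ := SL2.exists_isProfile_of_simple h2F hδ V
  obtain ⟨v, c, d, l, m, hg, hnorm', hinv, hne'⟩ := SL2.exists_isProfile_of_simple h2F hδ W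
  obtain ⟨e, he, hdeg⟩ : ∃ e : ℕ, e ≤ 2 ∧ V.character 1 = Fintype.card F - 1 + e := by
    rcases hχdeg with h | h | h
    · exact ⟨0, by norm_num, by rw [h]; simp⟩
    · exact ⟨1, by norm_num, by rw [h]; simp⟩
    · exact ⟨2, by norm_num, by rw [h]; push_cast; ring⟩
  obtain ⟨rfl, rfl, rfl, rfl, rfl⟩ := hf.eq_of_apply_one hq9 hnorm he hdeg
  have hmain : ∑ x : Matrix.SpecialLinearGroup (Fin 2) F,
      V.character x ^ 2 * (starRingEnd ℂ) (W.character x) ≠ 0 := by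
    rcases Nat.eq_zero_or_pos (c + d) with hcd | hcd
    · obtain ⟨rfl, rfl⟩ : c = 0 ∧ d = 0 := by omega
      have hv : v ≤ 1 := by
        have h1 := hg.split.abs_le
        have h2 := hg.nonsplit.abs_le
        push_cast at h2
        rw [zero_sub, abs_neg, Nat.abs_cast] at h2
        rw [Nat.abs_cast] at h1
        norm_num at hnorm'
        omega
      have hW1 : Module.finrank ℂ W ≤ 1 := by
        have h1 := hg.apply_one
        norm_num at h1
        omega
      have hWconst (x) : W.character x = W.character 1 := by
        rw [FDRep.character, FDRep.character, map_eq_one_of_finrank_le_one hperfect W.ρ hW1,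
          map_one W.ρ]
      have hW0 : W.character 1 ≠ 0 := by
        intro h0
        exact hne' (Finset.sum_eq_zero fun x _ => by rw [hWconst, h0, zero_mul])
      simp only [hWconst]
      rw [← Finset.sum_mul]
      refine mul_ne_zero ?_ ((map_ne_zero _).2 hW0)
      rw [hf.sum_sq_eq h2F hδ]
      exact hne
    · exact hf.sum_sq_mul_conj_ne_zero h2F hδ hq4 he hg hnorm' hcd hinv
  rw [charInner]
  let : Fintype (Matrix.ProjectiveSpecialLinearGroup (Fin 2) F) := Fintype.ofFinite _
  refine mul_ne_zero (inv_ne_zero (Nat.cast_ne_zero.2 Fintype.card_ne_zero)) fun h0 => hmain ?_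
  obtain ⟨r, -, hr⟩ := exists_sum_comp_eq_mul
    (QuotientGroup.mk' (Subgroup.center (Matrix.SpecialLinearGroup (Fin 2) F)))
    (QuotientGroup.mk'_surjective _)
  exact (hr fun g => V.character g ^ 2 * (starRingEnd ℂ) (W.character g)).trans
    (by rw [h0, mul_zero])
end

section
/- Let q ≥ 9 be a prime power with q ≡ 1 (mod 4), and let G = PSL₂(q). Then for every irreducible complex character χ of G of degree (q + 1)/2 and every irreducible complex character ψ of G, the inner product ⟨χ³, ψ⟩ is nonzero; that is, c(χ³) = Irr(G). -/
open scoped BigOperators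

section

open Module Matrix

theorem Module.End.exists_trace_pow_eq_sum {V : Type*} [AddCommGroup V] [Module ℂ V]
    [FiniteDimensional ℂ V] (f : End ℂ V) {n : ℕ} (hn : 0 < n) (hf : f ^ n = 1) :
    ∃ μ : Fin (finrank ℂ V) → ℂ, (∀ i, μ i ^ n = 1) ∧
      ∀ k : ℕ, LinearMap.trace ℂ V (f ^ k) = ∑ i, μ i ^ k := by
  classical
  have hsep : (Polynomial.X ^ n - 1 : Polynomial ℂ).Separable :=
    Polynomial.separable_X_pow_sub_C 1 (by exact_mod_cast hn.ne') one_ne_zero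
  have hss : f.IsSemisimple := by
    refine isSemisimple_of_squarefree_aeval_eq_zero hsep.squarefree ?_
    simp [hf]
  have hint := (DirectSum.isInternal_submodule_iff_iSupIndep_and_iSup_eq_top _).mpr
    ⟨f.eigenspaces_iSupIndep, hss.iSup_eigenspace_eq_top⟩
  let b₀ := hint.collectedBasis fun μ => Module.finBasis ℂ (f.eigenspace μ)
  have hb₀ : ∀ i, f (b₀ i) = i.1 • b₀ i := fun i =>
    Module.End.mem_eigenspace_iff.mp (hint.collectedBasis_mem _ i)
  let := FiniteDimensional.fintypeBasisIndex b₀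
  let b := b₀.reindex (Fintype.equivFinOfCardEq (finrank_eq_card_basis b₀).symm)
  obtain ⟨μ, hμ⟩ : ∃ μ : Fin (finrank ℂ V) → ℂ, ∀ i, f (b i) = μ i • b i :=
    ⟨fun i => ((Fintype.equivFinOfCardEq (finrank_eq_card_basis b₀).symm).symm i).1,
      fun i => by simp only [b, Basis.reindex_apply]; exact hb₀ _⟩
  have hpow : ∀ k i, (f ^ k) (b i) = μ i ^ k • b i := by
    intro k i
    induction k with
    | zero => simp
    | succ k ih => rw [pow_succ', End.mul_apply, ih, map_smul, hμ, smul_smul, pow_succ]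
  refine ⟨μ, fun i => ?_, fun k => ?_⟩
  · have := hpow n i
    rw [hf, End.one_apply] at this
    have h2 : (μ i ^ n - 1) • b i = 0 := by rw [sub_smul, ← this, one_smul, sub_self]
    exact sub_eq_zero.mp ((smul_eq_zero.mp h2).resolve_right (b.ne_zero i))
  · rw [LinearMap.trace_eq_matrix_trace ℂ b, Matrix.trace]
    refine Finset.sum_congr rfl fun i _ => ?_
    simp [LinearMap.toMatrix_apply, hpow]

theorem Module.End.norm_trace_le_finrank {V : Type*} [AddCommGroup V] [Module ℂ V]
    [FiniteDimensional ℂ V] (f : End ℂ V) {n : ℕ} (hn : 0 < n) (hf : f ^ n = 1) :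
    ‖LinearMap.trace ℂ V f‖ ≤ finrank ℂ V := by
  obtain ⟨μ, h1, h2⟩ := f.exists_trace_pow_eq_sum hn hf
  have := h2 1
  simp only [pow_one] at this
  rw [this]
  refine (norm_sum_le _ _).trans ?_
  simp [fun i => Complex.norm_eq_one_of_pow_eq_one (h1 i) hn.ne']

theorem Module.End.norm_trace_eq_one {V : Type*} [AddCommGroup V] [Module ℂ V]
    [FiniteDimensional ℂ V] (f : End ℂ V) {n : ℕ} (hn : 0 < n) (hf : f ^ n = 1)
    (hV : finrank ℂ V = 1) : ‖LinearMap.trace ℂ V f‖ = 1 := by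
  obtain ⟨μ, h1, h2⟩ := f.exists_trace_pow_eq_sum hn hf
  have := h2 1
  simp only [pow_one] at this
  rw [this]
  have e : ∀ i, ‖μ i‖ = 1 := fun i => Complex.norm_eq_one_of_pow_eq_one (h1 i) hn.ne'
  revert μ
  rw [hV]
  intro μ _ _ _ e
  simp [e]

theorem Representation.char_inv_eq_conj {G V : Type*} [Group G] [Finite G] [AddCommGroup V]
    [Module ℂ V] [FiniteDimensional ℂ V] (ρ : Representation ℂ G V) (g : G) :
    ρ.character g⁻¹ = (starRingEnd ℂ) (ρ.character g) := by
  have hn : 0 < orderOf g := orderOf_pos g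
  obtain ⟨μ, h1, h2⟩ := Module.End.exists_trace_pow_eq_sum (ρ g) hn
    (by rw [← map_pow, pow_orderOf_eq_one, map_one])
  have hinv : g⁻¹ = g ^ (orderOf g - 1) := by
    rw [inv_eq_iff_mul_eq_one, ← pow_succ', Nat.sub_add_cancel hn, pow_orderOf_eq_one]
  have h3 := h2 1
  rw [pow_one] at h3
  rw [Representation.character, Representation.character, hinv, map_pow, h2, h3, map_sum]
  refine Finset.sum_congr rfl fun i _ => ?_
  have hμ : ‖μ i‖ = 1 := Complex.norm_eq_one_of_pow_eq_one (h1 i) hn.ne'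
  rw [pow_one, ← Complex.inv_eq_conj hμ]
  exact eq_inv_of_mul_eq_one_left (by rw [← pow_succ, Nat.sub_add_cancel hn, h1])

/-- If all elements `g * h`, with `h` in the range of `φ`, have the same character value, then this
value is the trace of `g` on the fixed space of `φ`. -/
theorem Representation.char_eq_trace_on_invariants {G H V : Type*} [Group G] [Finite G] [Group H]
    [Fintype H] [AddCommGroup V] [Module ℂ V] [FiniteDimensional ℂ V] (ρ : Representation ℂ G V)
    (σ : Representation ℂ H V) (φ : H →* G) (hσ : ∀ h, σ h = ρ (φ h)) (g : G)
    (hg : ∀ h, ρ.character (g * φ h) = ρ.character g)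
    (hnorm : ∀ h, ∃ h', g⁻¹ * φ h * g = φ h') :
    ∃ f : End ℂ (invariants σ), f ^ orderOf g = 1 ∧ LinearMap.trace ℂ _ f = ρ.character g := by
  have hmaps : ∀ v ∈ invariants σ, ρ g v ∈ invariants σ := by
    intro v hv h
    obtain ⟨h', hh'⟩ := hnorm h
    have : φ h * g = g * φ h' := by rw [← hh']; group
    have hv' : ρ (φ h') v = v := by rw [← hσ]; exact hv h'
    rw [hσ, ← End.mul_apply, ← map_mul, this, map_mul, End.mul_apply, hv']
  let : Invertible (Fintype.card H : ℂ) := invertibleOfNonzero (by simp)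
  set e := averageMap σ with he
  have hfix : ∀ v ∈ invariants σ, e v = v := σ.averageMap_id
  have hmem : ∀ v, (ρ g * e) v ∈ invariants σ := fun v =>
    hmaps _ (σ.averageMap_invariant v)
  refine ⟨(ρ g).restrict hmaps, ?_, ?_⟩
  · ext v
    rw [Module.End.pow_restrict]
    simp [← map_pow, pow_orderOf_eq_one]
  · have h1 := LinearMap.trace_restrict_eq_of_forall_mem (R := ℂ) (invariants σ) (ρ g * e) hmem
    have h2 : (ρ g).restrict hmaps = (ρ g * e).restrict (fun v _ => hmem v) := by
      ext v
      simp [hfix v.1 v.2]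
    rw [h2, h1, he]
    have : ρ g * σ.averageMap = (Fintype.card H : ℂ)⁻¹ • ∑ h, ρ (g * φ h) := by
      simp only [averageMap, GroupAlgebra.average, map_smul, map_sum, map_mul, mul_smul_comm,
        Finset.mul_sum]
      simp [Representation.asAlgebraHom_single, hσ]
    rw [this, map_smul, map_sum]
    have h3 : ∀ h, LinearMap.trace ℂ V (ρ (g * φ h)) = ρ.character g := hg
    simp only [h3, Finset.sum_const]
    simp

/-- The number of elements conjugating `g` into `B`. -/
def conjCount {G : Type*} [Group G] [Fintype G] [DecidableEq G] (B : Finset G) (g : G) : ℕ :=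
  (Finset.univ.filter fun h => h * g * h⁻¹ ∈ B).card

theorem conjCount_conj {G : Type*} [Group G] [Fintype G] [DecidableEq G] (B : Finset G) (g k : G) :
    conjCount B (k * g * k⁻¹) = conjCount B g := by
  refine Finset.card_bij (fun h _ => h * k) ?_ ?_ ?_
  · intro h hh
    simpa [mul_assoc] using hh
  · intro a _ b _ hab
    exact mul_right_cancel hab
  · intro h hh
    exact ⟨h * k⁻¹, by simpa [mul_assoc] using hh, by simp⟩

theorem sum_ite_conjCount {G : Type*} [Group G] [Fintype G] [DecidableEq G] (B : Finset G)
    (f : G → ℂ) (hf : ∀ g h, f (h * g * h⁻¹) = f g) :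
    ∑ g, (if conjCount B g = 0 then 0 else f g) =
      Fintype.card G * ∑ b ∈ B, f b / conjCount B b := by
  have hF : ∀ h, ∑ b ∈ B, f b / conjCount B b =
      ∑ g, if h * g * h⁻¹ ∈ B then f g / conjCount B g else 0 := by
    intro h
    rw [← Fintype.sum_equiv (MulAut.conj h⁻¹).toEquiv
      (fun b => if b ∈ B then f b / conjCount B b else 0)]
    · simp
    · intro b
      have h1 : f (h⁻¹ * b * h) = f b := by simpa using hf b h⁻¹
      have h2 : conjCount B (h⁻¹ * b * h) = conjCount B b := by simpa using conjCount_conj B b h⁻¹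
      simp [mul_assoc] at h1 h2 ⊢
      simp [h1, h2]
  have h1 : (Fintype.card G : ℂ) * ∑ b ∈ B, f b / conjCount B b =
      ∑ h : G, ∑ g, if h * g * h⁻¹ ∈ B then f g / conjCount B g else 0 := by
    rw [← Finset.sum_congr rfl fun h _ => hF h]
    simp
  rw [h1, Finset.sum_comm]
  refine Finset.sum_congr rfl fun g _ => ?_
  rw [← Finset.sum_filter, Finset.sum_const, ← conjCount, nsmul_eq_mul]
  split_ifs with h
  · simp [h]
  · field_simp

namespace Matrix.SpecialLinearGroup

variable {F : Type*} [Field F]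

/-- The upper triangular matrix with diagonal `(s, s⁻¹)` and upper right entry `t`. -/
def borel (s : Fˣ) (t : F) : SpecialLinearGroup (Fin 2) F :=
  ⟨!![(s : F), t; 0, (s : F)⁻¹], by simp [det_fin_two]⟩

/-- The matrix with nonzero lower left entry `z` and diagonal `(x, w)`. -/
def bigCell (z : Fˣ) (w x : F) : SpecialLinearGroup (Fin 2) F :=
  ⟨!![x, (x * w - 1) * (z : F)⁻¹; (z : F), w], by simp [det_fin_two]⟩

@[simp]
theorem val_borel (s : Fˣ) (t : F) : (borel s t).1 = !![(s : F), t; 0, (s : F)⁻¹] := rfl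

@[simp]
theorem val_bigCell (z : Fˣ) (w x : F) :
    (bigCell z w x).1 = !![x, (x * w - 1) * (z : F)⁻¹; (z : F), w] := rfl

theorem Units.sub_inv_ne_zero {s : Fˣ} (hs : s ^ 2 ≠ 1) : (s : F) - (s : F)⁻¹ ≠ 0 := by
  intro h
  refine hs (Units.ext ?_)
  have h2 : (s : F) = (s : F)⁻¹ := sub_eq_zero.mp h
  rw [Units.val_pow_eq_pow_val, sq, Units.val_one]
  nth_rewrite 2 [h2]
  exact mul_inv_cancel₀ s.ne_zero

theorem bijective_borel_bigCell : Function.Bijective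
    (Sum.elim (fun p : Fˣ × F => borel p.1 p.2) fun p : Fˣ × F × F => bigCell p.1 p.2.1 p.2.2) := by
  constructor
  · rintro (⟨s, t⟩ | ⟨z, w, x⟩) (⟨s', t'⟩ | ⟨z', w', x'⟩) h <;>
      simp only [Sum.elim_inl, Sum.elim_inr] at h <;>
      have h00 := congrArg (fun g : SpecialLinearGroup (Fin 2) F => g.1 0 0) h <;>
      have h01 := congrArg (fun g : SpecialLinearGroup (Fin 2) F => g.1 0 1) h <;>
      have h10 := congrArg (fun g : SpecialLinearGroup (Fin 2) F => g.1 1 0) h <;>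
      have h11 := congrArg (fun g : SpecialLinearGroup (Fin 2) F => g.1 1 1) h <;>
      simp at h00 h01 h10 h11 <;> simp_all [Units.ext_iff]
    exact absurd h10 z'.ne_zero.symm
  · intro g
    have hdet := g.2
    rw [det_fin_two] at hdet
    by_cases hz : g.1 1 0 = 0
    · rw [hz, mul_zero, sub_zero] at hdet
      refine ⟨Sum.inl (⟨g.1 0 0, g.1 1 1, hdet, by rw [mul_comm, hdet]⟩, g.1 0 1), ?_⟩
      ext i j
      fin_cases i <;> fin_cases j <;> simp [hz]
      exact inv_eq_of_mul_eq_one_right hdet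
    · refine ⟨Sum.inr (Units.mk0 _ hz, g.1 1 1, g.1 0 0), ?_⟩
      ext i j
      fin_cases i <;> fin_cases j <;> simp
      field_simp
      linear_combination hdet

theorem borel_conj_borel_lower_left (s s' : Fˣ) (t t' : F) :
    (borel s' t' * borel s t * (borel s' t')⁻¹).1 1 0 = 0 := by
  simp [coe_mul, coe_inv, adjugate_fin_two, Matrix.mul_apply, Fin.sum_univ_two]

theorem bigCell_conj_borel_lower_left (s z : Fˣ) (t w x : F) :
    (bigCell z w x * borel s t * (bigCell z w x)⁻¹).1 1 0 =
      z * (w * (s - (s : F)⁻¹) - z * t) := by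
  simp [coe_mul, coe_inv, adjugate_fin_two, Matrix.mul_apply, Fin.sum_univ_two]
  ring

theorem conj_borel_zero (s : Fˣ) (t : F) (hs : s ^ 2 ≠ 1) :
    ∃ h, borel s t = h * borel s 0 * h⁻¹ := by
  have hs' := Units.sub_inv_ne_zero hs
  obtain ⟨c, hc⟩ : ∃ c : F, c * ((s : F) - (s : F)⁻¹) = -t := ⟨_, div_mul_cancel₀ _ hs'⟩
  refine ⟨borel 1 c, ?_⟩
  ext i j
  fin_cases i <;> fin_cases j <;>
    simp [coe_mul, coe_inv, adjugate_fin_two, Matrix.mul_apply, Fin.sum_univ_two]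
  linear_combination hc

theorem borel_neg_one (t : F) :
    borel (-1) t = (-1 : SpecialLinearGroup (Fin 2) F) * borel 1 (-t) := by
  ext i j
  fin_cases i <;> fin_cases j <;> simp

variable [Fintype F] [DecidableEq F]

theorem sum_eq_borel_add_bigCell {M : Type*} [AddCommMonoid M]
    (f : SpecialLinearGroup (Fin 2) F → M) :
    ∑ g, f g = ∑ s : Fˣ, ∑ t, f (borel s t) + ∑ z : Fˣ, ∑ w, ∑ x, f (bigCell z w x) := by
  rw [← Fintype.sum_bijective _ bijective_borel_bigCell _ f fun _ => rfl]
  simp [Fintype.sum_prod_type]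

theorem card_fin_two : Fintype.card (SpecialLinearGroup (Fin 2) F) =
    (Fintype.card F - 1) * Fintype.card F * (Fintype.card F + 1) := by
  have := sum_eq_borel_add_bigCell (F := F) fun _ => 1
  simp only [Finset.sum_const, Finset.card_univ, smul_eq_mul, mul_one, Fintype.card_units] at this
  rw [this]
  ring

/-- The upper triangular matrices of determinant one. -/
def borelFinset (F : Type*) [Field F] [Fintype F] [DecidableEq F] :
    Finset (SpecialLinearGroup (Fin 2) F) :=
  Finset.univ.filter fun g => g.1 1 0 = 0

theorem mem_borelFinset (g : SpecialLinearGroup (Fin 2) F) :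
    g ∈ borelFinset F ↔ g.1 1 0 = 0 := by
  simp [borelFinset]

theorem sum_borelFinset {M : Type*} [AddCommMonoid M] (f : SpecialLinearGroup (Fin 2) F → M) :
    ∑ b ∈ borelFinset F, f b = ∑ s : Fˣ, ∑ t, f (borel s t) := by
  rw [borelFinset, Finset.sum_filter, sum_eq_borel_add_bigCell]
  simp

theorem conjCount_borelFinset (g : SpecialLinearGroup (Fin 2) F) : conjCount (borelFinset F) g =
    ∑ s : Fˣ, ∑ t : F, (if (borel s t * g * (borel s t)⁻¹).1 1 0 = 0 then 1 else 0) +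
    ∑ z : Fˣ, ∑ w, ∑ x, if (bigCell z w x * g * (bigCell z w x)⁻¹).1 1 0 = 0 then 1 else 0 := by
  rw [conjCount, Finset.card_filter, sum_eq_borel_add_bigCell]
  simp only [mem_borelFinset]

theorem conjCount_borel (s : Fˣ) (t : F) : conjCount (borelFinset F) (borel s t) =
    (Fintype.card F - 1) * Fintype.card F *
      (if s ^ 2 ≠ 1 then 2 else if t = 0 then Fintype.card F + 1 else 1) := by
  rw [conjCount_borelFinset]
  simp only [borel_conj_borel_lower_left, bigCell_conj_borel_lower_left, if_true, Finset.sum_const,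
    Finset.card_univ, smul_eq_mul, mul_one, Fintype.card_units, mul_eq_zero, Units.ne_zero,
    false_or]
  by_cases hs : s ^ 2 = 1
  · have hs0 : (s : F) - (s : F)⁻¹ = 0 := by
      rw [sub_eq_zero]
      refine eq_inv_of_mul_eq_one_left ?_
      rw [← sq, ← Units.val_pow_eq_pow_val, hs, Units.val_one]
    by_cases ht : t = 0
    · simp [hs, hs0, ht, Fintype.card_units]; ring
    · simp [hs, hs0, ht]
  · have hs' : (s : F) - (s : F)⁻¹ ≠ 0 := Units.sub_inv_ne_zero hs
    have : ∀ (z : Fˣ) (w : F), w * (s - (s : F)⁻¹) - z * t = 0 ↔ w = z * t / (s - (s : F)⁻¹) := by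
      intro z w
      rw [sub_eq_zero, eq_div_iff hs']
    simp [this, hs, Fintype.card_units]
    ring

/-- The sum of a class function, invariant under `-1`, over the elements of `SL₂(F)` fixing
a line. -/
theorem sum_ite_conjCount_borelFinset (hF : (2 : F) ≠ 0) (f : SpecialLinearGroup (Fin 2) F → ℂ)
    (hf : ∀ g h, f (h * g * h⁻¹) = f g) (hneg : ∀ g, f (-1 * g) = f g) :
    ∑ g, (if conjCount (borelFinset F) g = 0 then 0 else f g) =
      2 * (f 1 + (Fintype.card F + 1) * ∑ t ∈ Finset.univ.erase 0, f (borel 1 t)) +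
      Fintype.card F * (Fintype.card F + 1) / 2 *
        ∑ s ∈ (Finset.univ.erase (1 : Fˣ)).erase (-1), f (borel s 0) := by
  have hq : 1 < Fintype.card F := Fintype.one_lt_card
  have hne : (-1 : Fˣ) ≠ 1 := by
    intro h
    have := congrArg (Units.val) h
    simp only [Units.val_neg, Units.val_one] at this
    exact hF (by linear_combination -this)
  have hq0 : (Fintype.card F : ℂ) ≠ 0 := by simp
  have hq1 : (Fintype.card F : ℂ) - 1 ≠ 0 := by
    rw [sub_ne_zero]; exact_mod_cast hq.ne'
  have hq2 : (Fintype.card F : ℂ) + 1 ≠ 0 := by exact_mod_cast Nat.succ_ne_zero (Fintype.card F)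
  have hone : borel (1 : Fˣ) (0 : F) = 1 := by
    ext i j
    fin_cases i <;> fin_cases j <;> simp
  rw [sum_ite_conjCount _ f hf, sum_borelFinset]
  rw [← Finset.add_sum_erase _ _ (Finset.mem_univ (1 : Fˣ)),
    ← Finset.add_sum_erase _ _ (Finset.mem_erase.mpr ⟨hne, Finset.mem_univ (-1 : Fˣ)⟩)]
  have hneg1 : ∑ t, f (borel (-1) t) / conjCount (borelFinset F) (borel (-1) t) =
      ∑ t, f (borel 1 t) / conjCount (borelFinset F) (borel 1 t) := by
    refine Fintype.sum_equiv (Equiv.neg F) _ _ fun t => ?_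
    rw [borel_neg_one, hneg, ← borel_neg_one, conjCount_borel, conjCount_borel]
    simp
  have hpos1 : ∑ t, f (borel 1 t) / conjCount (borelFinset F) (borel 1 t) =
      f 1 / ((Fintype.card F - 1) * Fintype.card F * (Fintype.card F + 1)) +
      (∑ t ∈ Finset.univ.erase 0, f (borel 1 t)) / ((Fintype.card F - 1) * Fintype.card F) := by
    rw [← Finset.add_sum_erase _ _ (Finset.mem_univ (0 : F)), hone, ← hone, conjCount_borel, hone,
      Finset.sum_div]
    congr 1
    · simp [Nat.cast_sub hq.le]
    · refine Finset.sum_congr rfl fun t ht => ?_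
      rw [conjCount_borel]
      simp [Nat.cast_sub hq.le, (Finset.mem_erase.mp ht).1]
  have hrest : ∀ s ∈ (Finset.univ.erase (1 : Fˣ)).erase (-1),
      ∑ t, f (borel s t) / conjCount (borelFinset F) (borel s t) =
        f (borel s 0) / ((Fintype.card F - 1) * 2) := by
    intro s hs
    have hs2 : s ^ 2 ≠ 1 := by
      simp only [Finset.mem_erase, Finset.mem_univ, and_true] at hs
      intro h
      have h' : ((s : F)) ^ 2 = 1 := by rw [← Units.val_pow_eq_pow_val, h, Units.val_one]
      rcases (sq_eq_sq_iff_eq_or_eq_neg.mp (h'.trans (one_pow 2).symm)) with h1 | h1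
      · exact hs.2 (Units.ext h1)
      · exact hs.1 (Units.ext h1)
    have : ∀ t, f (borel s t) / conjCount (borelFinset F) (borel s t) =
        f (borel s 0) / ((Fintype.card F - 1) * Fintype.card F * 2) := by
      intro t
      obtain ⟨h, hh⟩ := conj_borel_zero s t hs2
      rw [conjCount_borel, hh, hf]
      simp [Nat.cast_sub hq.le, hs2]
    simp only [this, Finset.sum_const, Finset.card_univ, nsmul_eq_mul]
    field_simp
  rw [Finset.sum_congr rfl hrest, hneg1, hpos1, ← Finset.sum_div, card_fin_two]
  push_cast [Nat.cast_sub hq.le]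
  field_simp
  ring

end Matrix.SpecialLinearGroup

namespace Matrix.SpecialLinearGroup

variable {F : Type*} [Field F]

/-- The embedding of the additive group of `F` as upper unitriangular matrices. -/
def unipotentHom (F : Type*) [Field F] : Multiplicative F →* SpecialLinearGroup (Fin 2) F where
  toFun t := borel 1 t.toAdd
  map_one' := by
    ext i j
    fin_cases i <;> fin_cases j <;> simp
  map_mul' s t := by
    ext i j
    fin_cases i <;> fin_cases j <;>
      simp [coe_mul, Matrix.mul_apply, Fin.sum_univ_two, add_comm]

theorem borel_zero_conj_borel_one (s : Fˣ) (t : F) :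
    borel s 0 * borel 1 t * (borel s 0)⁻¹ = borel 1 (t * s ^ 2) := by
  ext i j
  fin_cases i <;> fin_cases j <;>
    simp [coe_mul, coe_inv, adjugate_fin_two, Matrix.mul_apply, Fin.sum_univ_two]
  ring

theorem inv_borel_zero_conj_borel_one (s : Fˣ) (t : F) :
    (borel s 0)⁻¹ * borel 1 t * borel s 0 = borel 1 (t * (s : F)⁻¹ ^ 2) := by
  ext i j
  fin_cases i <;> fin_cases j <;>
    simp [coe_mul, coe_inv, adjugate_fin_two, Matrix.mul_apply, Fin.sum_univ_two]
  ring

theorem borel_zero_mul_borel_one (s : Fˣ) (t : F) : borel s 0 * borel 1 t = borel s (s * t) := by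
  ext i j
  fin_cases i <;> fin_cases j <;> simp [coe_mul, Matrix.mul_apply, Fin.sum_univ_two]

/-- The monomial matrices of determinant one. -/
def monomialSubgroup (F : Type*) [Field F] : Subgroup (SpecialLinearGroup (Fin 2) F) where
  carrier := {g | (g.1 1 0 = 0 ∧ g.1 0 1 = 0) ∨ (g.1 0 0 = 0 ∧ g.1 1 1 = 0)}
  one_mem' := by simp
  mul_mem' := by
    rintro a b (⟨h1, h2⟩ | ⟨h1, h2⟩) (⟨h3, h4⟩ | ⟨h3, h4⟩) <;>
      simp [coe_mul, Matrix.mul_apply, Fin.sum_univ_two, *]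
  inv_mem' := by
    rintro a (⟨h1, h2⟩ | ⟨h1, h2⟩) <;> simp [coe_inv, adjugate_fin_two, *]

theorem conj_bigCell_zero {i : Fˣ} (hi : (i : F) ^ 2 = -1) (z : Fˣ) :
    ∃ h, h * bigCell z 0 0 * h⁻¹ = borel i (z : F)⁻¹ := by
  have hii : (i : F)⁻¹ = -i := by
    refine inv_eq_of_mul_eq_one_right ?_
    linear_combination -hi
  refine ⟨bigCell (i * z) 1 0, ?_⟩
  ext j k
  fin_cases j <;> fin_cases k <;>
    simp [coe_mul, coe_inv, adjugate_fin_two, Matrix.mul_apply, Fin.sum_univ_two, hii]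
  all_goals field_simp
  all_goals first | linear_combination -hi | linear_combination (z : F) * hi

variable {V : Type*} [AddCommGroup V] [Module ℂ V]
  (ρ : Representation ℂ (SpecialLinearGroup (Fin 2) F) V)

/-- The restriction of `ρ` to the unipotent subgroup, twisted by an additive character. -/
def unipotentTwist (θ : AddChar F ℂ) : Representation ℂ (Multiplicative F) V where
  toFun t := θ t.toAdd • ρ (unipotentHom F t)
  map_one' := by simp
  map_mul' s t := by
    simp only [toAdd_mul, AddChar.map_add_eq_mul, map_mul]
    rw [smul_mul_smul_comm]

variable [Fintype F]

theorem char_borel_one_eq [DecidableEq F] (hF : ringChar F ≠ 2) : ∃ A B : ℂ, ∀ t ≠ 0,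
    ρ.character (borel 1 t) = A + B * quadraticChar F t := by
  obtain ⟨n, hn⟩ := quadraticChar_exists_neg_one hF
  have hn0 : n ≠ 0 := by rintro rfl; simp at hn
  have key : ∀ t y : F, y ≠ 0 → ρ.character (borel 1 (t * y ^ 2)) = ρ.character (borel 1 t) := by
    intro t y hy
    have := borel_zero_conj_borel_one (Units.mk0 y hy) t
    rw [Units.val_mk0] at this
    rw [← this, ρ.char_conj]
  refine ⟨(ρ.character (borel 1 1) + ρ.character (borel 1 n)) / 2,
    (ρ.character (borel 1 1) - ρ.character (borel 1 n)) / 2, fun t ht => ?_⟩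
  rcases quadraticChar_dichotomy ht with h | h
  · obtain ⟨y, rfl⟩ := (quadraticChar_one_iff_isSquare ht).mp h
    have hy : y ≠ 0 := by rintro rfl; simp at ht
    have := key 1 y hy
    rw [one_mul, sq] at this
    rw [h, this]
    push_cast
    ring
  · have htn : t / n ≠ 0 := div_ne_zero ht hn0
    have h1 : quadraticChar F (t / n) = 1 := by
      have h2 : quadraticChar F (t / n) * quadraticChar F n = quadraticChar F t := by
        rw [← map_mul, div_mul_cancel₀ _ hn0]
      rw [hn, h] at h2
      linarith
    obtain ⟨y, hy⟩ := (quadraticChar_one_iff_isSquare htn).mp h1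
    have hy0 : y ≠ 0 := by rintro rfl; simp at hy; tauto
    have ht2 : t = n * y ^ 2 := by rw [sq, ← hy, mul_div_cancel₀ _ hn0]
    rw [h, ht2, key n y hy0]
    push_cast
    ring

variable [FiniteDimensional ℂ V]

theorem sum_char_mul_addChar (θ : AddChar F ℂ) :
    ∑ t, θ t * ρ.character (borel 1 t) =
      Fintype.card F * (finrank ℂ (unipotentTwist ρ θ).invariants : ℂ) := by
  let : Invertible (Nat.card (Multiplicative F) : ℂ) := invertibleOfNonzero (by simp)
  have h := (unipotentTwist ρ θ).card_inv_mul_sum_char_eq_finrank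
  have hc : (Nat.card (Multiplicative F) : ℂ) = Fintype.card F := by simp
  rw [hc, inv_mul_eq_iff_eq_mul₀ (by simp)] at h
  rw [← h]
  refine Fintype.sum_equiv Multiplicative.ofAdd _ _ fun t => ?_
  simp [Representation.character, unipotentTwist, unipotentHom]

theorem norm_char_borel_zero (s : Fˣ) (hs : s ^ 2 ≠ 1) :
    ‖ρ.character (borel s 0)‖ ≤ finrank ℂ (unipotentTwist ρ 1).invariants ∧
    (finrank ℂ (unipotentTwist ρ 1).invariants = 1 → ‖ρ.character (borel s 0)‖ = 1) := by
  obtain ⟨f, hf, htr⟩ := ρ.char_eq_trace_on_invariants (unipotentTwist ρ 1) (unipotentHom F)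
    (fun h => by simp [unipotentTwist]) (borel s 0)
    (fun t => by
      obtain ⟨k, hk⟩ := conj_borel_zero s (s * t.toAdd) hs
      change ρ.character (borel s 0 * borel 1 t.toAdd) = _
      rw [borel_zero_mul_borel_one, hk, ρ.char_conj])
    (fun t => ⟨Multiplicative.ofAdd (t.toAdd * (s : F)⁻¹ ^ 2),
      by exact inv_borel_zero_conj_borel_one s t.toAdd⟩)
  classical
  rw [← htr]
  exact ⟨f.norm_trace_le_finrank (orderOf_pos _) hf, f.norm_trace_eq_one (orderOf_pos _) hf⟩

theorem sq_ne_one_of_mem_erase [DecidableEq F] {s : Fˣ} (hs : s ∈ (Finset.univ.erase (1 : Fˣ)).erase (-1)) :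
    s ^ 2 ≠ 1 := by
  intro h
  simp only [Finset.mem_erase, Finset.mem_univ, and_true] at hs
  have h' : (s : F) ^ 2 = 1 ^ 2 := by rw [← Units.val_pow_eq_pow_val, h, Units.val_one, one_pow]
  rcases sq_eq_sq_iff_eq_or_eq_neg.mp h' with h1 | h1
  · exact hs.2 (Units.ext h1)
  · exact hs.1 (Units.ext h1)

theorem even_of_char_borel_zero_eq_zero (hF : (2 : F) ≠ 0) (hsq : IsSquare (-1 : F))
    (hneg : ρ (-1) = 1) (h0 : ∀ s : Fˣ, s ^ 2 ≠ 1 → ρ.character (borel s 0) = 0) :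
    ∃ k : ℕ, 2 * ρ.character 1 = 2 * (Fintype.card F - 1) * k := by
  classical
  have hq : 1 < Fintype.card F := Fintype.one_lt_card
  obtain ⟨i, hi⟩ : ∃ i : Fˣ, (i : F) ^ 2 = -1 := by
    obtain ⟨i, hi⟩ := hsq
    have : i ≠ 0 := by rintro rfl; simp at hi
    exact ⟨Units.mk0 i this, by rw [Units.val_mk0, hi, sq]⟩
  have hi2 : i ^ 2 ≠ 1 := by
    intro h
    have := congrArg Units.val h
    rw [Units.val_pow_eq_pow_val, hi, Units.val_one] at this
    exact hF (by linear_combination -this)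
  have hbig : ∀ z : Fˣ, ρ.character (bigCell z 0 0) = 0 := by
    intro z
    obtain ⟨h, hh⟩ := conj_bigCell_zero hi z
    obtain ⟨k, hk⟩ := conj_borel_zero i (z : F)⁻¹ hi2
    rw [← ρ.char_conj _ h, hh, hk, ρ.char_conj, h0 i hi2]
  have hne : (-1 : Fˣ) ≠ 1 := by
    intro h
    have := congrArg (Units.val) h
    simp only [Units.val_neg, Units.val_one] at this
    exact hF (by linear_combination -this)
  have hone : borel (1 : Fˣ) (0 : F) = 1 := map_one (unipotentHom F)
  have hmone : ρ.character (borel (-1 : Fˣ) (0 : F)) = ρ.character 1 := by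
    rw [borel_neg_one, neg_zero, hone]
    simp [Representation.character, hneg]
  have htorus : ∑ s : Fˣ, ρ.character (borel s 0) = 2 * ρ.character 1 := by
    rw [← Finset.add_sum_erase _ _ (Finset.mem_univ (1 : Fˣ)),
      ← Finset.add_sum_erase _ _ (Finset.mem_erase.mpr ⟨hne, Finset.mem_univ (-1 : Fˣ)⟩),
      Finset.sum_eq_zero, hone, hmone]
    · ring
    · exact fun s hs => h0 s (sq_ne_one_of_mem_erase hs)
  have hsum : ∀ f : SpecialLinearGroup (Fin 2) F → ℂ, ∑ g : monomialSubgroup F, f g =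
      ∑ s : Fˣ, f (borel s 0) + ∑ z : Fˣ, f (bigCell z 0 0) := by
    intro f
    rw [← Finset.sum_subtype (Finset.univ.filter (· ∈ monomialSubgroup F)) (by simp) f,
      Finset.sum_filter, sum_eq_borel_add_bigCell]
    have h1 : ∀ (s : Fˣ) (t : F), borel s t ∈ monomialSubgroup F ↔ t = 0 := by
      intro s t
      change (_ ∧ _) ∨ (_ ∧ _) ↔ _
      simp
    have h2 : ∀ (z : Fˣ) (w x : F), bigCell z w x ∈ monomialSubgroup F ↔ x = 0 ∧ w = 0 := by
      intro z w x
      change (_ ∧ _) ∨ (_ ∧ _) ↔ _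
      simp
    simp only [h1, h2, ite_and]
    simp
  let : Invertible (Nat.card (monomialSubgroup F) : ℂ) := invertibleOfNonzero (by simp)
  let σ : Representation ℂ (monomialSubgroup F) V := ρ.comp (monomialSubgroup F).subtype
  refine ⟨finrank ℂ σ.invariants, ?_⟩
  have h := σ.card_inv_mul_sum_char_eq_finrank
  have hc : (Nat.card (monomialSubgroup F) : ℂ) = 2 * (Fintype.card F - 1) := by
    have := hsum fun _ => 1
    simp only [Finset.sum_const, Finset.card_univ, nsmul_eq_mul, mul_one, Fintype.card_units,
      Nat.cast_sub hq.le] at this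
    rw [Nat.card_eq_fintype_card, this]
    push_cast
    ring
  rw [inv_mul_eq_iff_eq_mul₀ (by simp), hc] at h
  rw [← h, ← htorus]
  have := hsum ρ.character
  simp only [hbig, Finset.sum_const_zero, add_zero] at this
  rw [← this]
  rfl

end Matrix.SpecialLinearGroup

theorem ringChar_ne_two_of_card_mod_four {F : Type*} [Field F] [Fintype F]
    (hq : Fintype.card F % 4 = 1) :
    ringChar F ≠ 2 := fun h => by
  have := FiniteField.even_card_iff_char_two.mp h
  omega

theorem exists_gaussSum_quadraticChar {F : Type*} [Field F] [Fintype F] [DecidableEq F]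
    (hq : Fintype.card F % 4 = 1) : ∃ (θ₁ θ₂ : AddChar F ℂ) (G : ℂ), G = √(Fintype.card F : ℝ) ∧
      ∑ t, θ₁ t = 0 ∧ ∑ t, θ₂ t = 0 ∧
      ∑ t, (quadraticChar F t : ℂ) * θ₁ t = G ∧ ∑ t, (quadraticChar F t : ℂ) * θ₂ t = -G := by
  have h2 : ringChar F ≠ 2 := ringChar_ne_two_of_card_mod_four hq
  obtain ⟨n, hn⟩ := quadraticChar_exists_neg_one h2
  have hn0 : n ≠ 0 := by rintro rfl; simp at hn
  set θ := AddChar.FiniteField.primitiveChar_to_Complex F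
  have hθ : θ.IsPrimitive := AddChar.FiniteField.primitiveChar_to_Complex_isPrimitive F
  set η : MulChar F ℂ := (quadraticChar F).ringHomComp (Int.castRingHom ℂ)
  have hη : ∀ t, η t = (quadraticChar F t : ℂ) := fun t => rfl
  have hsum : ∀ x ≠ 0, ∑ t, θ.mulShift x t = 0 := by
    intro x hx
    have := AddChar.sum_mulShift x hθ
    simpa [AddChar.mulShift_apply, mul_comm, hx] using this
  have hsq : gaussSum η θ ^ 2 = Fintype.card F := by
    rw [gaussSum_sq ((MulChar.ringHomComp_ne_one_iff Int.cast_injective).mpr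
      (quadraticChar_ne_one h2)) ((quadraticChar_isQuadratic F).comp _) hθ, hη,
      (quadraticChar_one_iff_isSquare (by simp)).mpr
        (FiniteField.isSquare_neg_one_iff.mpr (by omega))]
    simp
  have hshift : gaussSum η (θ.mulShift n) = - gaussSum η θ := by
    have := gaussSum_mulShift η θ (Units.mk0 n hn0)
    rw [Units.val_mk0, hη, hn] at this
    rw [← this]
    simp
  have h1 : θ.mulShift 1 = θ := by ext; simp
  have hG : gaussSum η θ ^ 2 = ((√(Fintype.card F : ℝ) : ℝ) : ℂ) ^ 2 := by
    rw [hsq, ← Complex.ofReal_pow, Real.sq_sqrt (Nat.cast_nonneg _)]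
    simp
  rcases sq_eq_sq_iff_eq_or_eq_neg.mp hG with h | h
  · refine ⟨θ, θ.mulShift n, _, rfl, ?_, hsum n hn0, h, ?_⟩
    · simpa [h1] using hsum 1 one_ne_zero
    · exact hshift.trans (by rw [h])
  · refine ⟨θ.mulShift n, θ, _, rfl, hsum n hn0, ?_, ?_, h⟩
    · simpa [h1] using hsum 1 one_ne_zero
    · exact hshift.trans (by rw [h, neg_neg])

namespace Matrix.SpecialLinearGroup

variable {F : Type*} [Field F] [Fintype F] [DecidableEq F]

/-- The character `χ` of `SL₂(F)` restricts to the Borel subgroup like the sum of `a` linear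
characters and of `b`, respectively `c`, copies of the two characters of degree `(q - 1) / 2`. -/
structure BorelData (χ : SpecialLinearGroup (Fin 2) F → ℂ) (a b c : ℕ) : Prop where
  one : χ 1 = a + (Fintype.card F - 1) / 2 * (b + c)
  unipotent : ∀ t ≠ 0, χ (borel 1 t) =
    a - (b + c) / 2 + (b - c) / 2 * (quadraticChar F t * (√(Fintype.card F : ℝ) : ℝ))
  norm_torus_le : ∀ s : Fˣ, s ^ 2 ≠ 1 → ‖χ (borel s 0)‖ ≤ a
  norm_torus_eq : a = 1 → ∀ s : Fˣ, s ^ 2 ≠ 1 → ‖χ (borel s 0)‖ = 1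
  even : a = 0 → Even (b + c)

variable {V : Type*} [AddCommGroup V] [Module ℂ V] [FiniteDimensional ℂ V]
  (ρ : Representation ℂ (SpecialLinearGroup (Fin 2) F) V)

theorem exists_borelData (hq : Fintype.card F % 4 = 1) (hneg : ρ (-1) = 1) :
    ∃ a b c : ℕ, BorelData ρ.character a b c := by
  have h2 : ringChar F ≠ 2 := ringChar_ne_two_of_card_mod_four hq
  have hqpos : 0 < Fintype.card F := Fintype.card_pos
  have hq1 : 1 < Fintype.card F := Fintype.one_lt_card
  have hq0 : (Fintype.card F : ℂ) ≠ 0 := by exact_mod_cast hqpos.ne'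
  have hq10 : (Fintype.card F : ℂ) - 1 ≠ 0 := by
    rw [sub_ne_zero]
    exact_mod_cast hq1.ne'
  obtain ⟨A, B, hAB⟩ := char_borel_one_eq ρ h2
  obtain ⟨θ₁, θ₂, G, hG, h1, h2', hg1, hg2⟩ := exists_gaussSum_quadraticChar hq
  have hone : borel (1 : Fˣ) (0 : F) = 1 := map_one (unipotentHom F)
  have key : ∀ θ : AddChar F ℂ, ρ.character 1 - A + A * ∑ t, θ t +
      B * ∑ t, (quadraticChar F t : ℂ) * θ t =
      Fintype.card F * (finrank ℂ (unipotentTwist ρ θ).invariants : ℂ) := by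
    intro θ
    have hsplit : ∀ f : F → ℂ, ∑ t, f t = f 0 + ∑ t ∈ Finset.univ.erase 0, f t :=
      fun f => (Finset.add_sum_erase _ f (Finset.mem_univ 0)).symm
    rw [← sum_char_mul_addChar, hsplit θ, hsplit fun t => (quadraticChar F t : ℂ) * θ t,
      hsplit fun t => θ t * _, hone, Finset.sum_congr rfl
      (f := fun t => θ t * _) (g := fun t => A * θ t + B * ((quadraticChar F t : ℂ) * θ t))
        fun t ht => by rw [hAB t (Finset.ne_of_mem_erase ht)]; ring,
      Finset.sum_add_distrib, ← Finset.mul_sum, ← Finset.mul_sum]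
    simp
    ring
  have k0 := key 1
  have k1 := key θ₁
  have k2 := key θ₂
  have hη : ∑ t, (quadraticChar F t : ℂ) = 0 := by exact_mod_cast quadraticChar_sum_zero h2
  rw [h1, hg1] at k1
  rw [h2', hg2] at k2
  simp only [AddChar.one_apply, mul_one, hη, Finset.sum_const, Finset.card_univ, nsmul_eq_mul]
    at k0
  set a := finrank ℂ (unipotentTwist ρ 1).invariants
  set b := finrank ℂ (unipotentTwist ρ θ₁).invariants
  set c := finrank ℂ (unipotentTwist ρ θ₂).invariants
  set D := ρ.character 1
  set q : ℂ := (Fintype.card F : ℂ)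
  have hG2 : G ^ 2 = q := by
    rw [hG, ← Complex.ofReal_pow, Real.sq_sqrt (Nat.cast_nonneg _)]
    simp [q]
  have hA : A = a - (b + c) / 2 := by
    apply mul_left_cancel₀ hq0
    linear_combination k0 - k1 / 2 - k2 / 2
  have hD : D = a + (q - 1) / 2 * (b + c) := by
    linear_combination k1 / 2 + k2 / 2 + hA
  have hB : B = (b - c) / 2 * G := by
    apply mul_left_cancel₀ hq0
    linear_combination -B * hG2 + G / 2 * k1 - G / 2 * k2
  have hle := fun s hs => (norm_char_borel_zero ρ s hs).1
  refine ⟨a, b, c, hD, fun t ht => ?_, hle, fun ha s hs => (norm_char_borel_zero ρ s hs).2 ha,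
    fun ha => ?_⟩
  · rw [hAB t ht, hA, hB, hG]
    ring
  · obtain ⟨k, hk⟩ := even_of_char_borel_zero_eq_zero ρ (Ring.two_ne_zero h2)
      (FiniteField.isSquare_neg_one_iff.mpr (by omega)) hneg fun s hs => by
        have := hle s hs
        rw [show finrank ℂ (unipotentTwist ρ 1).invariants = 0 from ha, Nat.cast_zero] at this
        exact norm_le_zero_iff.mp this
    refine ⟨k, ?_⟩
    have : ((b + c : ℕ) : ℂ) = ((k + k : ℕ) : ℂ) := by
      apply mul_left_cancel₀ hq10
      rw [ha] at hD
      push_cast at hD ⊢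
      linear_combination hk - 2 * hD
    exact_mod_cast this

end Matrix.SpecialLinearGroup

namespace Matrix.SpecialLinearGroup

variable {F : Type*} [Field F] [Fintype F]

variable [DecidableEq F]

theorem sum_erase_zero_of_quadraticChar (hF : ringChar F ≠ 2) {f : F → ℂ} (Φ : ℤ → ℂ)
    (hf : ∀ t ≠ 0, f t = Φ (quadraticChar F t)) :
    ∑ t ∈ Finset.univ.erase 0, f t = (Fintype.card F - 1) / 2 * (Φ 1 + Φ (-1)) := by
  have hη : ∑ t ∈ Finset.univ.erase (0 : F), (quadraticChar F t : ℂ) = 0 := by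
    rw [Finset.sum_erase _ (by simp)]
    exact_mod_cast quadraticChar_sum_zero hF
  have h : ∀ t ∈ Finset.univ.erase (0 : F), f t =
      (Φ 1 + Φ (-1)) / 2 + (Φ 1 - Φ (-1)) / 2 * quadraticChar F t := by
    intro t ht
    rw [hf t (Finset.ne_of_mem_erase ht)]
    rcases quadraticChar_dichotomy (Finset.ne_of_mem_erase ht) with h | h <;> rw [h] <;>
      push_cast <;> ring
  rw [Finset.sum_congr rfl h, Finset.sum_add_distrib, ← Finset.mul_sum, hη]
  have : 1 ≤ Fintype.card F := Fintype.card_pos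
  simp [Nat.cast_sub this]
  ring

theorem card_erase_erase_units (hF : (2 : F) ≠ 0) :
    ((((Finset.univ.erase (1 : Fˣ)).erase (-1)).card : ℕ) : ℝ) = Fintype.card F - 3 := by
  have hne : (-1 : Fˣ) ≠ 1 := by
    intro h
    have := congrArg Units.val h
    simp only [Units.val_neg, Units.val_one] at this
    exact hF (by linear_combination -this)
  have h1 := Finset.card_erase_add_one (Finset.mem_erase.mpr ⟨hne, Finset.mem_univ (-1 : Fˣ)⟩)
  have h2 := Finset.card_erase_add_one (Finset.mem_univ (1 : Fˣ))
  rw [Finset.card_univ, Fintype.card_units] at h2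
  have h3 : ((Finset.univ.erase (1 : Fˣ)).erase (-1)).card + 3 = Fintype.card F := by
    have : 1 < Fintype.card F := Fintype.one_lt_card
    omega
  rw [← h3]
  push_cast
  ring

namespace BorelData

variable {χ ψ : SpecialLinearGroup (Fin 2) F → ℂ} {a b c a' b' c' : ℕ}

theorem sum_ite_norm_sq (h : BorelData χ a b c) (hF : ringChar F ≠ 2)
    (hconj : ∀ g k, χ (k * g * k⁻¹) = χ g) (hneg : ∀ g, χ (-1 * g) = χ g) :
    ∑ g, (if conjCount (borelFinset F) g = 0 then 0 else ‖χ g‖ ^ 2) =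
      2 * ((a + (Fintype.card F - 1) / 2 * (b + c)) ^ 2 + ((Fintype.card F : ℝ) ^ 2 - 1) *
        ((a - (b + c) / 2) ^ 2 + Fintype.card F * ((b - c) / 2) ^ 2)) +
      Fintype.card F * (Fintype.card F + 1) / 2 *
        ∑ s ∈ (Finset.univ.erase (1 : Fˣ)).erase (-1), ‖χ (borel s 0)‖ ^ 2 := by
  have hr : √(Fintype.card F : ℝ) ^ 2 = Fintype.card F := Real.sq_sqrt (Nat.cast_nonneg _)
  have key := sum_ite_conjCount_borelFinset (Ring.two_ne_zero hF) (fun g => ((‖χ g‖ ^ 2 : ℝ) : ℂ))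
    (fun g k => by rw [hconj]) (fun g => by rw [hneg])
  have h1 : ‖χ 1‖ ^ 2 = (a + (Fintype.card F - 1) / 2 * (b + c)) ^ 2 := by
    rw [h.one, ← sq_abs (_ + _), ← Real.norm_eq_abs, ← Complex.norm_real]
    push_cast
    rfl
  let Φ : ℤ → ℂ := fun n =>
    (((a - (b + c) / 2 + (b - c) / 2 * (n * √(Fintype.card F : ℝ))) ^ 2 : ℝ) : ℂ)
  have h2 : ∀ t ≠ 0, ((‖χ (borel 1 t)‖ ^ 2 : ℝ) : ℂ) = Φ (quadraticChar F t) := by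
    intro t ht
    rw [h.unipotent t ht]
    simp only [Φ]
    rw [← sq_abs (_ + _), ← Real.norm_eq_abs, ← Complex.norm_real]
    push_cast
    rfl
  rw [sum_erase_zero_of_quadraticChar hF Φ h2, h1] at key
  apply Complex.ofReal_injective
  have hL : ((∑ g, (if conjCount (borelFinset F) g = 0 then 0 else ‖χ g‖ ^ 2) : ℝ) : ℂ) =
      ∑ g, (if conjCount (borelFinset F) g = 0 then 0 else ((‖χ g‖ ^ 2 : ℝ) : ℂ)) := by
    rw [Complex.ofReal_sum]
    refine Finset.sum_congr rfl fun g _ => ?_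
    split_ifs <;> simp
  have hr' : ((√(Fintype.card F : ℝ) : ℝ) : ℂ) ^ 2 = Fintype.card F := by exact_mod_cast hr
  rw [hL, key]
  simp only [Φ]
  push_cast
  linear_combination ((Fintype.card F : ℂ) ^ 2 - 1) * 2 * ((b - c) / 2) ^ 2 * hr'

theorem norm_ineq (h : BorelData χ a b c) (hF : ringChar F ≠ 2)
    (hconj : ∀ g k, χ (k * g * k⁻¹) = χ g) (hneg : ∀ g, χ (-1 * g) = χ g)
    (hnorm : ∑ g, ‖χ g‖ ^ 2 = Fintype.card (SpecialLinearGroup (Fin 2) F)) (m : ℝ)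
    (hm : (Fintype.card F : ℝ) = 2 * m + 1) :
    (m * (b - c)) ^ 2 + m * (a - b) ^ 2 + m * (a - c) ^ 2 + m * (b ^ 2 + c ^ 2) + a ^ 2 ≤
      2 * m ^ 2 + 2 * m := by
  have hq : (1 : ℝ) < Fintype.card F := by exact_mod_cast Fintype.one_lt_card (α := F)
  have hle : ∑ g, (if conjCount (borelFinset F) g = 0 then 0 else ‖χ g‖ ^ 2) ≤ ∑ g, ‖χ g‖ ^ 2 := by
    refine Finset.sum_le_sum fun g _ => ?_
    split_ifs
    · positivity
    · exact le_rfl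
  have htorus : 0 ≤ ∑ s ∈ (Finset.univ.erase (1 : Fˣ)).erase (-1), ‖χ (borel s 0)‖ ^ 2 :=
    Finset.sum_nonneg fun _ _ => by positivity
  rw [h.sum_ite_norm_sq hF hconj hneg, hnorm, card_fin_two] at hle
  push_cast [Nat.cast_sub (Fintype.card_pos (α := F) : 1 ≤ _)] at hle
  rw [hm] at hle hq
  have hm0 : 0 < m := by linarith
  have := mul_nonneg (by positivity : 0 ≤ (2 * m + 1) * (2 * m + 1 + 1) / 2) htorus
  refine le_of_mul_le_mul_left ?_ (by linarith : 0 < 2 * (2 * m + 1))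
  linarith

theorem sub_le (h : BorelData χ a b c) (hF : ringChar F ≠ 2) (hq : 9 ≤ Fintype.card F)
    (hconj : ∀ g k, χ (k * g * k⁻¹) = χ g) (hneg : ∀ g, χ (-1 * g) = χ g)
    (hnorm : ∑ g, ‖χ g‖ ^ 2 = Fintype.card (SpecialLinearGroup (Fin 2) F)) :
    b ≤ a + c ∧ c ≤ a + b := by
  have hq' : (9 : ℝ) ≤ Fintype.card F := by exact_mod_cast hq
  obtain ⟨m, hm⟩ : ∃ m : ℝ, (Fintype.card F : ℝ) = 2 * m + 1 :=
    ⟨((Fintype.card F : ℝ) - 1) / 2, by ring⟩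
  have hineq := h.norm_ineq hF hconj hneg hnorm m hm
  have hm4 : 4 ≤ m := by linarith
  have h1 : (m * (b - c)) ^ 2 < (m * 2) ^ 2 := by
    have : 0 ≤ m * ((a : ℝ) - b) ^ 2 + m * (a - c) ^ 2 + m * (b ^ 2 + c ^ 2) + a ^ 2 := by
      positivity
    nlinarith
  obtain ⟨h2, h3⟩ := abs_lt_of_sq_lt_sq' h1 (by linarith)
  have h4 : (b : ℝ) - c < 2 := lt_of_mul_lt_mul_left h3 (by linarith)
  have h5 : (-2 : ℝ) < b - c := lt_of_mul_lt_mul_left (by linarith) (by linarith : 0 ≤ m)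
  have h6 : b < c + 2 := by exact_mod_cast (by linarith : (b : ℝ) < c + 2)
  have h7 : c < b + 2 := by exact_mod_cast (by linarith : (c : ℝ) < b + 2)
  rcases Nat.eq_zero_or_pos a with ha | ha
  · obtain ⟨k, hk⟩ := h.even ha
    omega
  · omega

theorem eq_one_of_degree (h : BorelData χ a b c) (hF : ringChar F ≠ 2) (hq : 9 ≤ Fintype.card F)
    (hconj : ∀ g k, χ (k * g * k⁻¹) = χ g) (hneg : ∀ g, χ (-1 * g) = χ g)
    (hnorm : ∑ g, ‖χ g‖ ^ 2 = Fintype.card (SpecialLinearGroup (Fin 2) F))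
    (hdeg : χ 1 = ((Fintype.card F : ℂ) + 1) / 2) : a = 1 ∧ b + c = 1 := by
  have hq' : (9 : ℝ) ≤ Fintype.card F := by exact_mod_cast hq
  have hdeg' : (a + (Fintype.card F - 1) / 2 * (b + c) : ℝ) = (Fintype.card F + 1) / 2 := by
    apply Complex.ofReal_injective
    push_cast
    rw [← h.one, hdeg]
  obtain ⟨m, hm⟩ : ∃ m : ℝ, (Fintype.card F : ℝ) = 2 * m + 1 :=
    ⟨((Fintype.card F : ℝ) - 1) / 2, by ring⟩
  have hineq := h.norm_ineq hF hconj hneg hnorm m hm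
  have hm4 : 4 ≤ m := by linarith
  have hd : (a : ℝ) + m * ((b + c : ℕ) : ℝ) = m + 1 := by
    rw [hm] at hdeg'
    push_cast
    linarith
  have ha0 : (0 : ℝ) ≤ a := Nat.cast_nonneg a
  rcases Nat.lt_trichotomy (b + c) 1 with hbc | hbc | hbc
  · obtain ⟨rfl, rfl⟩ : b = 0 ∧ c = 0 := by omega
    exfalso
    simp only [add_zero, Nat.cast_zero, mul_zero] at hd
    rw [hd] at hineq
    push_cast at hineq
    nlinarith
  · refine ⟨?_, hbc⟩
    rw [hbc] at hd
    push_cast at hd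
    exact_mod_cast (by linarith : (a : ℝ) = 1)
  · exfalso
    have : (2 : ℝ) ≤ ((b + c : ℕ) : ℝ) := by exact_mod_cast hbc
    nlinarith

theorem eq_zero_of_conjCount_eq_zero (h : BorelData χ 1 b c) (hbc : b + c = 1)
    (hF : ringChar F ≠ 2) (hconj : ∀ g k, χ (k * g * k⁻¹) = χ g)
    (hneg : ∀ g, χ (-1 * g) = χ g)
    (hnorm : ∑ g, ‖χ g‖ ^ 2 = Fintype.card (SpecialLinearGroup (Fin 2) F))
    {g : SpecialLinearGroup (Fin 2) F} (hg : conjCount (borelFinset F) g = 0) : χ g = 0 := by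
  have htorus : ∑ s ∈ (Finset.univ.erase (1 : Fˣ)).erase (-1), ‖χ (borel s 0)‖ ^ 2 =
      Fintype.card F - 3 := by
    rw [← card_erase_erase_units (Ring.two_ne_zero hF), Finset.sum_congr rfl fun s hs => by
      rw [h.norm_torus_eq rfl s (sq_ne_one_of_mem_erase hs)]]
    simp
  have hsum : ∑ g, (‖χ g‖ ^ 2 - if conjCount (borelFinset F) g = 0 then 0 else ‖χ g‖ ^ 2) = 0 := by
    have hb : (b : ℝ) = 1 - c := by
      rw [eq_sub_iff_add_eq]
      exact_mod_cast hbc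
    have hcc : (c : ℝ) ^ 2 = c := by
      obtain rfl | rfl : c = 0 ∨ c = 1 := by omega
      all_goals simp
    rw [Finset.sum_sub_distrib, h.sum_ite_norm_sq hF hconj hneg, htorus, hnorm, card_fin_two]
    push_cast [Nat.cast_sub (Fintype.card_pos (α := F) : 1 ≤ _)]
    rw [hb]
    linear_combination -2 * ((Fintype.card F : ℝ) ^ 2 - 1) * Fintype.card F * hcc
  have := (Finset.sum_eq_zero_iff_of_nonneg fun g _ => by
    split_ifs
    · simp
    · simp).mp hsum g (Finset.mem_univ g)
  simpa [hg] using this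

theorem re_sum_pow_three_mul_conj_pos (h : BorelData χ 1 b c) (hbc : b + c = 1)
    (hF : ringChar F ≠ 2) (hq : 9 ≤ Fintype.card F)
    (hχconj : ∀ g k, χ (k * g * k⁻¹) = χ g) (hχneg : ∀ g, χ (-1 * g) = χ g)
    (hχ0 : ∀ g, conjCount (borelFinset F) g = 0 → χ g = 0)
    (hψ : BorelData ψ a' b' c') (hψconj : ∀ g k, ψ (k * g * k⁻¹) = ψ g)
    (hψneg : ∀ g, ψ (-1 * g) = ψ g) (hb : b' ≤ a' + c') (hc : c' ≤ a' + b')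
    (hψ1 : ψ 1 ≠ 0) : 0 < (∑ g, χ g ^ 3 * starRingEnd ℂ (ψ g)).re := by
  have key := sum_ite_conjCount_borelFinset (Ring.two_ne_zero hF)
    (fun g => χ g ^ 3 * starRingEnd ℂ (ψ g)) (fun g k => by rw [hχconj, hψconj])
    (fun g => by rw [hχneg, hψneg])
  have hL : ∑ g, (if conjCount (borelFinset F) g = 0 then 0 else χ g ^ 3 * starRingEnd ℂ (ψ g)) =
      ∑ g, χ g ^ 3 * starRingEnd ℂ (ψ g) := by
    refine Finset.sum_congr rfl fun g _ => ?_
    split_ifs with hg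
    · simp [hχ0 g hg]
    · rfl
  have hbc' : (c : ℂ) = 1 - b := by
    rw [eq_sub_iff_add_eq']
    exact_mod_cast hbc
  have hbb : (b : ℂ) ^ 2 = b := by
    obtain rfl | rfl : b = 0 ∨ b = 1 := by omega
    all_goals simp
  let Φ : ℤ → ℂ := fun n => (1 / 2 + (b - 1 / 2) * (n * (√(Fintype.card F : ℝ) : ℝ))) ^ 3 *
    (a' - (b' + c') / 2 + (b' - c') / 2 * (n * (√(Fintype.card F : ℝ) : ℝ)))
  have hΦ : ∀ t ≠ 0, χ (borel 1 t) ^ 3 * starRingEnd ℂ (ψ (borel 1 t)) =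
      Φ (quadraticChar F t) := by
    intro t ht
    rw [h.unipotent t ht, hψ.unipotent t ht, hbc']
    simp only [Φ, map_add, map_sub, map_mul, map_div₀, map_natCast, map_intCast, map_ofNat,
      Complex.conj_ofReal]
    push_cast
    ring
  have hr : ((√(Fintype.card F : ℝ) : ℝ) : ℂ) ^ 2 = Fintype.card F := by
    exact_mod_cast Real.sq_sqrt (Nat.cast_nonneg (Fintype.card F))
  have hΦ' : Φ 1 + Φ (-1) = ((1 + 3 * Fintype.card F) * (a' - (b' + c') / 2) +
      (2 * b - 1) * Fintype.card F * (3 + Fintype.card F) * ((b' - c') / 2)) / 4 := by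
    simp only [Φ]
    generalize ((√(Fintype.card F : ℝ) : ℝ) : ℂ) = r at hr
    rw [← hr]
    push_cast
    linear_combination (3 * (a' - (b' + c') / 2) * r ^ 2 +
      2 * ((b' - c') / 2) * (b - 1 / 2) * r ^ 4) * hbb
  have hone : χ 1 ^ 3 * starRingEnd ℂ (ψ 1) = ((Fintype.card F + 1) / 2) ^ 3 *
      (a' + (Fintype.card F - 1) / 2 * (b' + c')) := by
    rw [h.one, hψ.one, hbc']
    simp only [map_add, map_sub, map_mul, map_div₀, map_natCast, map_ofNat, map_one]
    push_cast
    ring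
  set T := ∑ s ∈ (Finset.univ.erase (1 : Fˣ)).erase (-1),
    χ (borel s 0) ^ 3 * starRingEnd ℂ (ψ (borel s 0))
  have hT : ‖T‖ ≤ (Fintype.card F - 3) * a' := by
    rw [← card_erase_erase_units (Ring.two_ne_zero hF), ← nsmul_eq_mul]
    refine (norm_sum_le _ _).trans (Finset.sum_le_card_nsmul _ _ _ fun s hs => ?_)
    have hs' := sq_ne_one_of_mem_erase hs
    rw [norm_mul, norm_pow, h.norm_torus_eq rfl s hs', one_pow, one_mul, RCLike.norm_conj]
    exact hψ.norm_torus_le s hs'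
  have hTre := (abs_le.mp ((Complex.abs_re_le_norm T).trans hT)).1
  rw [hL, sum_erase_zero_of_quadraticChar hF Φ hΦ, hΦ', hone] at key
  have hre : ∑ g, χ g ^ 3 * starRingEnd ℂ (ψ g) =
      ((2 * (((Fintype.card F + 1) / 2) ^ 3 * (a' + (Fintype.card F - 1) / 2 * (b' + c')) +
        ((Fintype.card F : ℝ) ^ 2 - 1) / 2 * (((1 + 3 * Fintype.card F) * (a' - (b' + c') / 2) +
        (2 * b - 1) * Fintype.card F * (3 + Fintype.card F) * ((b' - c') / 2)) / 4)) : ℝ) : ℂ) +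
      (((Fintype.card F : ℝ) * (Fintype.card F + 1) / 2 : ℝ) : ℂ) * T := by
    rw [key]
    push_cast
    ring
  have hpos : 0 < a' + b' ∧ 0 < a' + c' := by
    rcases Nat.eq_zero_or_pos (a' + b' + c') with h0 | h0
    · obtain ⟨⟨rfl, rfl⟩, rfl⟩ : (a' = 0 ∧ b' = 0) ∧ c' = 0 := by omega
      exact absurd hψ.one (by simpa using hψ1)
    · omega
  rw [hre, Complex.add_re, Complex.re_ofReal_mul, Complex.ofReal_re]
  have hq' : (9 : ℝ) ≤ Fintype.card F := by exact_mod_cast hq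
  have hb' : (b' : ℝ) ≤ a' + c' := by exact_mod_cast hb
  have hc' : (c' : ℝ) ≤ a' + b' := by exact_mod_cast hc
  have hab : (0 : ℝ) < a' + b' := by exact_mod_cast hpos.1
  have hac : (0 : ℝ) < a' + c' := by exact_mod_cast hpos.2
  have hb0 : (0 : ℝ) ≤ b' := Nat.cast_nonneg b'
  have hc0 : (0 : ℝ) ≤ c' := Nat.cast_nonneg c'
  generalize (Fintype.card F : ℝ) = q at *
  have hq1 : 0 < q ^ 2 - 1 := by nlinarith
  have hTq := mul_le_mul_of_nonneg_left hTre (by positivity : 0 ≤ q * (q + 1) / 2)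
  have hgap : 0 < q * (q + 1) * ((q - 1) ^ 2 / 8 - 1) := by
    have : 0 < (q - 1) ^ 2 / 8 - 1 := by nlinarith
    positivity
  have hqq : 0 < q * (q + 1) := by positivity
  have hγ : 0 < (q ^ 2 - 1) * q / 4 := by positivity
  obtain rfl | rfl : b = 0 ∨ b = 1 := by omega
  · have h1 := mul_le_mul_of_nonneg_left hb' hγ.le
    have h2 := mul_pos hqq hac
    have h3 := mul_nonneg hgap.le hc0
    push_cast
    linarith
  · have h1 := mul_le_mul_of_nonneg_left hc' hγ.le
    have h2 := mul_pos hqq hab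
    have h3 := mul_nonneg hgap.le hb0
    push_cast
    linarith

end BorelData
end Matrix.SpecialLinearGroup

end

theorem MonoidHom.exists_sum_comp_eq {G H : Type*} [Group G] [Fintype G] [Group H] [Fintype H]
    (π : G →* H) (hπ : Function.Surjective π) :
    ∃ k : ℕ, Fintype.card G = k * Fintype.card H ∧
      ∀ {R : Type} [Semiring R] (f : H → R), ∑ g, f (π g) = k * ∑ h, f h := by
  classical
  have key : ∀ {R : Type} [Semiring R] (f : H → R), ∑ g, f (π g) =
      ((Finset.univ.filter fun g => π g = 1).card : R) * ∑ h, f h := by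
    intro R _ f
    rw [← Finset.sum_fiberwise Finset.univ π, Finset.mul_sum]
    refine Finset.sum_congr rfl fun h _ => ?_
    rw [Finset.sum_congr rfl (g := fun _ => f h) fun g hg => by rw [(Finset.mem_filter.mp hg).2],
      Finset.sum_const, nsmul_eq_mul, MonoidHom.card_fiber_eq_of_mem_range π (hπ h) (hπ 1)]
  refine ⟨_, ?_, key⟩
  simpa using key (R := ℕ) fun _ => 1

namespace IsIrreducibleCharacter

theorem sum_norm_sq {G : Type} [Group G] [Fintype G] {χ : G → ℂ}
    (hχ : IsIrreducibleCharacter G χ) : ∑ g, ‖χ g‖ ^ 2 = Fintype.card G := by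
  obtain ⟨V, _, rfl⟩ := hχ
  let : Invertible (Nat.card G : ℂ) := invertibleOfNonzero (by simp)
  have h := FDRep.char_orthonormal V V
  rw [if_pos ⟨CategoryTheory.Iso.refl V⟩, inv_mul_eq_iff_eq_mul₀ (by simp), mul_one] at h
  have hinv : ∀ g, V.character g⁻¹ = starRingEnd ℂ (V.character g) :=
    Representation.char_inv_eq_conj V.ρ
  simp only [hinv, Complex.mul_conj', Nat.card_eq_fintype_card] at h
  exact_mod_cast h

theorem one_ne_zero {G : Type} [Group G] [Fintype G] {χ : G → ℂ}
    (hχ : IsIrreducibleCharacter G χ) : χ 1 ≠ 0 := by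
  intro h1
  have hsum := hχ.sum_norm_sq
  obtain ⟨V, _, rfl⟩ := hχ
  rw [FDRep.char_one, Nat.cast_eq_zero] at h1
  have := Module.finrank_zero_iff.mp h1
  have h0 : ∀ g, V.character g = 0 := fun g => by
    change LinearMap.trace ℂ V.V (V.ρ g) = 0
    rw [Subsingleton.elim (V.ρ g) 0, map_zero]
  simp [h0] at hsum
  exact Fintype.card_ne_zero (α := G) (by exact_mod_cast hsum.symm)

theorem exists_borelData {F : Type} [Field F] [Fintype F] [DecidableEq F]
    (hq : Fintype.card F % 4 = 1) {χ : Matrix.ProjectiveSpecialLinearGroup (Fin 2) F → ℂ}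
    (hχ : IsIrreducibleCharacter _ χ) :
    (∀ g k : Matrix.SpecialLinearGroup (Fin 2) F,
      χ (QuotientGroup.mk (k * g * k⁻¹)) = χ (QuotientGroup.mk g)) ∧
    (∀ g : Matrix.SpecialLinearGroup (Fin 2) F,
      χ (QuotientGroup.mk (-1 * g)) = χ (QuotientGroup.mk g)) ∧
    ∃ a b c : ℕ, Matrix.SpecialLinearGroup.BorelData (fun g => χ (QuotientGroup.mk g)) a b c := by
  obtain ⟨V, _, rfl⟩ := hχ
  let π := QuotientGroup.mk' (Subgroup.center (Matrix.SpecialLinearGroup (Fin 2) F))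
  let ρ : Representation ℂ (Matrix.SpecialLinearGroup (Fin 2) F) V.V := V.ρ.comp π
  have hneg : ρ (-1) = 1 := by
    have : π (-1) = 1 := by
      refine (QuotientGroup.eq_one_iff _).mpr (Matrix.SpecialLinearGroup.mem_center_iff.mpr ?_)
      refine ⟨-1, by simp, ?_⟩
      ext i j
      fin_cases i <;> fin_cases j <;> simp
    change V.ρ (π (-1)) = 1
    rw [this, map_one]
  refine ⟨ρ.char_conj, fun g => ?_, Matrix.SpecialLinearGroup.exists_borelData ρ hq hneg⟩
  change LinearMap.trace ℂ V.V (ρ (-1 * g)) = LinearMap.trace ℂ V.V (ρ g)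
  rw [map_mul, hneg, one_mul]

end IsIrreducibleCharacter

/-- For a prime power `q ≥ 9` with `q ≡ 1 (mod 4)` and `G = PSL₂(q)`, the cube of any
irreducible character of degree `(q + 1)/2` contains every irreducible character of `G`. -/
theorem psl2_one_mod_four_half_degree_cube_covers
    (q : ℕ) (hq9 : 9 ≤ q) (hq : ∃ p n : ℕ, p.Prime ∧ 0 < n ∧ q = p ^ n) (hq4 : q % 4 = 1)
    (F : Type) [Field F] [Fintype F] (hF : Fintype.card F = q)
    (χ ψ : Matrix.ProjectiveSpecialLinearGroup (Fin 2) F → ℂ)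
    (hχ : IsIrreducibleCharacter _ χ) (hχdeg : χ 1 = ((q : ℂ) + 1) / 2)
    (hψ : IsIrreducibleCharacter _ ψ) :
    charInner (fun g => χ g ^ 3) ψ ≠ 0 := by
  classical
  subst hF
  let : Fintype (Matrix.ProjectiveSpecialLinearGroup (Fin 2) F) := Fintype.ofFinite _
  have h2 := ringChar_ne_two_of_card_mod_four hq4
  obtain ⟨k, hk, hsum⟩ := (QuotientGroup.mk' (Subgroup.center
    (Matrix.SpecialLinearGroup (Fin 2) F))).exists_sum_comp_eq (QuotientGroup.mk'_surjective _)
  have hnorm : ∀ {φ : Matrix.ProjectiveSpecialLinearGroup (Fin 2) F → ℂ},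
      IsIrreducibleCharacter _ φ →
      ∑ g : Matrix.SpecialLinearGroup (Fin 2) F, ‖φ (QuotientGroup.mk g)‖ ^ 2 =
        Fintype.card (Matrix.SpecialLinearGroup (Fin 2) F) := by
    intro φ hφ
    refine (hsum fun x => ‖φ x‖ ^ 2).trans ?_
    rw [hφ.sum_norm_sq, hk, Nat.cast_mul]
  obtain ⟨hχconj, hχneg, a, b, c, hχd⟩ := hχ.exists_borelData hq4
  obtain ⟨hψconj, hψneg, a', b', c', hψd⟩ := hψ.exists_borelData hq4
  obtain ⟨rfl, hbc⟩ := hχd.eq_one_of_degree h2 hq9 hχconj hχneg (hnorm hχ) hχdeg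
  obtain ⟨hb, hc⟩ := hψd.sub_le h2 hq9 hψconj hψneg (hnorm hψ)
  have hpos := hχd.re_sum_pow_three_mul_conj_pos hbc h2 hq9 hχconj hχneg
    (fun g hg => hχd.eq_zero_of_conjCount_eq_zero hbc h2 hχconj hχneg (hnorm hχ) hg)
    hψd hψconj hψneg hb hc hψ.one_ne_zero
  refine mul_ne_zero (by simp) fun h0 => ?_
  have := hsum fun x => χ x ^ 3 * starRingEnd ℂ (ψ x)
  rw [h0, mul_zero] at this
  exact hpos.ne' (congrArg Complex.re this)
end
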